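/- arXiv:1203.5206 — 9 statements merged into one kernel-verified Lean document; each statement's English description precedes it below -/
import Mathlib

section
/- Under assumptions (A1)–(A4) there exist two linearly independent, everywhere positive C² solutions g₁, g₂ : [0,∞) → ℝ of Lg = 0 such that: (i) g₁(0) = 1, g₁′(x) < 0 for x ∈ [0,x_λ), g₁′(x_λ) = 0, g₁′(x) > 0 for x ∈ (x_λ,∞), and g₁″(x) > 0 for x ∈ [x_λ,∞); moreover there exists at most one point z₀ > 0 with g₁″(z₀) = 0, and at such a point g₁‴(z₀) > 0; in particular g₁(x) > 0 for all x ≥ 0; (ii) g₂ is strictly increasing on [0,∞) with g₂(0) = 1 and g₂′(0) > 0. -/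
open Set Filter Topology

noncomputable def Lop (mu sig : ℝ → ℝ) (lam : ℝ) (g : ℝ → ℝ) (x : ℝ) : ℝ :=
  (1/2) * (sig x)^2 * deriv (deriv g) x + mu x * deriv g x - lam * g x

noncomputable def Wron (g₁ g₂ : ℝ → ℝ) (x : ℝ) : ℝ :=
  g₁ x * deriv g₂ x - g₂ x * deriv g₁ x

noncomputable def hfun (g₁ g₂ : ℝ → ℝ) (x : ℝ) : ℝ :=
  deriv (deriv g₂) x / deriv (deriv g₁) x

noncomputable def gb (g₁ g₂ : ℝ → ℝ) (β x : ℝ) : ℝ := g₂ x - β * g₁ x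

noncomputable def gb' (g₁ g₂ : ℝ → ℝ) (β x : ℝ) : ℝ := deriv g₂ x - β * deriv g₁ x

noncomputable def gb'' (g₁ g₂ : ℝ → ℝ) (β x : ℝ) : ℝ :=
  deriv (deriv g₂) x - β * deriv (deriv g₁) x

noncomputable def gam (k K : ℝ) (g₁ g₂ : ℝ → ℝ) (β x : ℝ) : ℝ :=
  k * (gb g₁ g₂ β x / gb' g₁ g₂ β x - x) + K

noncomputable def Jfun (k : ℝ) (g₁ g₂ : ℝ → ℝ) (β a₁ a₂ : ℝ) : ℝ :=
  k * (a₂ - a₁ - (gb g₁ g₂ β a₂ - gb g₁ g₂ β a₁) / gb' g₁ g₂ β a₂)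

/-- A Volterra integral gains one power of `|t - t₀|`. -/
lemma norm_intervalIntegral_le_of_norm_le_pow {E : Type*} [NormedAddCommGroup E] [NormedSpace ℝ E]
    {f : ℝ → E} (hf : Continuous f) {t₀ T c : ℝ} (n : ℕ)
    (h : ∀ s, |s - t₀| ≤ T → ‖f s‖ ≤ c * |s - t₀| ^ n) {t : ℝ} (ht : |t - t₀| ≤ T) :
    ‖∫ s in t₀..t, f s‖ ≤ c * (|t - t₀| ^ (n + 1) / (n + 1)) := by
  rw [← integral_pow_abs_sub_uIoc, ← MeasureTheory.integral_const_mul]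
  refine intervalIntegral.norm_integral_le_integral_norm_uIoc.trans ?_
  refine MeasureTheory.setIntegral_mono_on (Continuous.integrableOn_uIoc (by fun_prop))
    (Continuous.integrableOn_uIoc (by fun_prop)) measurableSet_uIoc fun s hs => h s ?_
  exact (Set.abs_sub_left_of_mem_uIcc (uIoc_subset_uIcc hs)).trans ht

/-- Global existence for linear differential equations with continuous coefficients. -/
theorem exists_forall_hasDerivAt_linear {E : Type*} [NormedAddCommGroup E] [NormedSpace ℝ E]
    [CompleteSpace E] {A : ℝ → E →L[ℝ] E} (hA : Continuous A) (t₀ : ℝ) (x₀ : E) :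
    ∃ y : ℝ → E, y t₀ = x₀ ∧ ∀ t, HasDerivAt y (A t (y t)) t := by
  let Y : ℕ → ℝ → E := fun n => n.rec (fun _ => x₀) fun _ u t => ∫ s in t₀..t, A s (u s)
  have hY0 : ∀ t, Y 0 t = x₀ := fun _ => rfl
  have hYs : ∀ n t, Y (n + 1) t = ∫ s in t₀..t, A s (Y n s) := fun _ _ => rfl
  have hYc : ∀ n, Continuous (Y n) := by
    intro n
    induction n with
    | zero => exact continuous_const
    | succ n ih =>
      exact intervalIntegral.continuous_primitive
        (fun a b => (hA.clm_apply ih).intervalIntegrable a b) t₀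
  let dY : ℕ → ℝ → E := fun n t => n.casesOn 0 fun n => A t (Y n t)
  have hd : ∀ n t, HasDerivAt (Y n) (dY n t) t := by
    rintro (_ | n) t
    · exact hasDerivAt_const t x₀
    · exact ((hA.clm_apply (hYc n)).integral_hasStrictDerivAt t₀ t).hasDerivAt
  refine ⟨fun t => ∑' n, Y n t, ?_, fun t => ?_⟩
  · refine (tsum_eq_single 0 ?_).trans (hY0 t₀)
    rintro (_ | n) hn
    · exact absurd rfl hn
    · simp [hYs]
  set T : ℝ := |t - t₀| + 1 with hT
  have hT0 : 0 ≤ T := by positivity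
  obtain ⟨M, hM⟩ := (isCompact_closedBall t₀ T).exists_bound_of_continuousOn hA.continuousOn
  have hM' : ∀ s, |s - t₀| ≤ T → ‖A s‖ ≤ M := fun s hs =>
    hM s (by rwa [Metric.mem_closedBall, Real.dist_eq])
  have hM0 : 0 ≤ M := (norm_nonneg _).trans (hM' t₀ (by simpa using hT0))
  have hYb : ∀ n s, |s - t₀| ≤ T → ‖Y n s‖ ≤ ‖x₀‖ * M ^ n / n.factorial * |s - t₀| ^ n := by
    intro n
    induction n with
    | zero => intro s _; simp [hY0]
    | succ n ih =>
      intro s hs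
      rw [hYs]
      refine (norm_intervalIntegral_le_of_norm_le_pow (hA.clm_apply (hYc n))
        (c := M * (‖x₀‖ * M ^ n / n.factorial)) n (fun r hr => ?_) hs).trans_eq ?_
      · rw [mul_assoc]
        exact (A r).le_of_opNorm_le_of_le (hM' r hr) (ih r hr)
      · rw [Nat.factorial_succ]
        push_cast
        field_simp
        ring
  have hYb' : ∀ n s, |s - t₀| ≤ T → ‖Y n s‖ ≤ ‖x₀‖ * ((M * T) ^ n / n.factorial) := by
    intro n s hs
    refine (hYb n s hs).trans ?_
    calc ‖x₀‖ * M ^ n / n.factorial * |s - t₀| ^ n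
        ≤ ‖x₀‖ * M ^ n / n.factorial * T ^ n := by gcongr
      _ = _ := by rw [mul_pow]; ring
  have hsum : Summable fun n : ℕ => ‖x₀‖ * ((M * T) ^ n / n.factorial) :=
    (Real.summable_pow_div_factorial _).mul_left _
  have hYsum : ∀ s, |s - t₀| ≤ T → Summable fun n => Y n s := fun s hs =>
    .of_norm_bounded hsum fun n => hYb' n s hs
  let u : ℕ → ℝ := fun n => n.casesOn 0 fun n => M * (‖x₀‖ * ((M * T) ^ n / n.factorial))
  have hu : Summable u := (summable_nat_add_iff 1).1 (hsum.mul_left M)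
  have hball : ∀ {s}, s ∈ Metric.ball t₀ T → |s - t₀| ≤ T := fun hs =>
    (Real.dist_eq _ _ ▸ Metric.mem_ball.1 hs).le
  have htT : |t - t₀| ≤ T := by linarith
  have key := hasDerivAt_tsum_of_isPreconnected (g := Y) (g' := dY) (y := t) hu
    (Metric.isOpen_ball (x := t₀) (ε := T)) (convex_ball t₀ T).isPreconnected
    (fun n s _ => hd n s)
    (by
      rintro (_ | n) s hs
      · simp [dY, u]
      · exact (A s).le_of_opNorm_le_of_le (hM' s (hball hs)) (hYb' n s (hball hs)))
    (Metric.mem_ball_self (by positivity)) (hYsum t₀ (by simpa using hT0))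
    (by rw [Metric.mem_ball, Real.dist_eq]; linarith)
  have hdsum : Summable fun n => dY n t :=
    (summable_nat_add_iff 1).1 ((A t).summable (hYsum t htT))
  rwa [hdsum.tsum_eq_zero_add, show dY 0 t = 0 from rfl, zero_add,
    show (∑' n, dY (n + 1) t) = A t (∑' n, Y n t) from ((A t).map_tsum (hYsum t htT)).symm] at key

/-- Initial value problem for `(P g')' = Q g`, with `v = P g'`. -/
theorem exists_sturmLiouville_solution {P Q : ℝ → ℝ} (hP : Continuous P) (hQ : Continuous Q)
    (hP0 : ∀ x, 0 < P x) (x₀ g₀ v₀ : ℝ) :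
    ∃ g v : ℝ → ℝ, g x₀ = g₀ ∧ v x₀ = v₀ ∧ (∀ x, HasDerivAt g (v x / P x) x) ∧
      ∀ x, HasDerivAt v (Q x * g x) x := by
  let A : ℝ → ℝ × ℝ →L[ℝ] ℝ × ℝ := fun x =>
    (P x)⁻¹ • (ContinuousLinearMap.inl ℝ ℝ ℝ).comp (ContinuousLinearMap.snd ℝ ℝ ℝ) +
      Q x • (ContinuousLinearMap.inr ℝ ℝ ℝ).comp (ContinuousLinearMap.fst ℝ ℝ ℝ)
  have hA : Continuous A :=
    ((hP.inv₀ fun x => (hP0 x).ne').smul continuous_const).add (hQ.smul continuous_const)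
  obtain ⟨y, hy0, hy⟩ := exists_forall_hasDerivAt_linear hA x₀ (g₀, v₀)
  refine ⟨fun x => (y x).1, fun x => (y x).2, by simp [hy0], by simp [hy0], fun x => ?_, fun x => ?_⟩
  · have h := (ContinuousLinearMap.fst ℝ ℝ ℝ).hasFDerivAt.comp_hasDerivAt x (hy x)
    convert! h using 1
    simp [A, div_eq_inv_mul]
  · have h := (ContinuousLinearMap.snd ℝ ℝ ℝ).hasFDerivAt.comp_hasDerivAt x (hy x)
    convert! h using 1
    simp [A]

/-- Solutions of `(P g')' = Q g` starting upwards from a positive value stay positive. -/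
theorem sturmLiouville_pos_right {P Q g v : ℝ → ℝ} (hP : ∀ x, 0 < P x) (hQ : ∀ x, 0 < Q x)
    (hg : ∀ x, HasDerivAt g (v x / P x) x) (hv : ∀ x, HasDerivAt v (Q x * g x) x)
    {x₀ : ℝ} (hg0 : 0 < g x₀) (hv0 : 0 ≤ v x₀) {x : ℝ} (hx : x₀ ≤ x) : 0 < g x := by
  have hgc : Continuous g := continuous_iff_continuousAt.2 fun x => (hg x).continuousAt
  have hw : Monotone (g * v) := by
    refine monotone_of_hasDerivAt_nonneg (fun x => (hg x).mul (hv x)) fun x => ?_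
    have h1 : v x / P x * v x = v x ^ 2 / P x := by ring
    have h2 : g x * (Q x * g x) = Q x * g x ^ 2 := by ring
    have := hP x
    have := hQ x
    simp only [Pi.zero_apply, h1, h2]
    positivity
  have hsq : MonotoneOn (g ^ 2) (Ici x₀) := by
    refine monotoneOn_of_hasDerivWithinAt_nonneg (convex_Ici x₀) (hgc.pow 2).continuousOn
      (fun x _ => ((hg x).pow 2).hasDerivWithinAt) fun x hx => ?_
    rw [interior_Ici] at hx
    have h1 : 0 ≤ g x * v x := (mul_nonneg hg0.le hv0).trans (hw (le_of_lt hx))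
    have h2 : ((2 : ℕ) : ℝ) * g x ^ (2 - 1) * (v x / P x) = 2 * (g x * v x / P x) := by
      push_cast; ring
    rw [h2]
    have := hP x
    positivity
  have hne : ∀ z, x₀ ≤ z → g z ≠ 0 := fun z hz h0 => by
    have := hsq self_mem_Ici hz hz
    simp only [Pi.pow_apply, h0] at this
    nlinarith
  by_contra! h
  obtain ⟨z, hz, hz0⟩ := intermediate_value_Icc' hx hgc.continuousOn ⟨h, hg0.le⟩
  exact hne z hz.1 hz0

theorem sturmLiouville_pos_left {P Q g v : ℝ → ℝ} (hP : ∀ x, 0 < P x) (hQ : ∀ x, 0 < Q x)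
    (hg : ∀ x, HasDerivAt g (v x / P x) x) (hv : ∀ x, HasDerivAt v (Q x * g x) x)
    {x₀ : ℝ} (hg0 : 0 < g x₀) (hv0 : v x₀ ≤ 0) {x : ℝ} (hx : x ≤ x₀) : 0 < g x := by
  have h := sturmLiouville_pos_right (P := fun x => P (-x)) (Q := fun x => Q (-x))
    (g := fun x => g (-x)) (v := fun x => -v (-x)) (x₀ := -x₀) (x := -x)
    (fun x => hP _) (fun x => hQ _)
    (fun x => by
      convert! (hg (-x)).comp x (hasDerivAt_neg x) using 1
      ring)
    (fun x => by
      convert! ((hv (-x)).comp x (hasDerivAt_neg x)).neg using 1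
      ring)
    (by simpa using hg0) (by simpa using hv0) (by linarith)
  simpa using h

theorem stmt_0    (lam k K C xlam : ℝ) (mu sig : ℝ → ℝ)
    (hlam : 0 < lam) (hk : 0 < k) (hK : 0 < K) (hC : 0 < C)
    (hA1 : ∀ x : ℝ, 0 ≤ x → |mu x| + |sig x| ≤ C * (1 + x))
    (hA2mu : ContDiff ℝ 1 mu) (hA2sig : ContDiff ℝ 1 sig)
    (hA2muL : ∃ M : NNReal, LipschitzWith M mu)
    (hA2sigL : ∃ M : NNReal, LipschitzWith M sig)
    (hA2muL' : ∃ M : NNReal, LipschitzWith M (deriv mu))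
    (hA2sigL' : ∃ M : NNReal, LipschitzWith M (deriv sig))
    (hA3 : ∀ x : ℝ, 0 ≤ x → 0 < (sig x)^2)
    (hxlam : 0 ≤ xlam)
    (hA4a : ∀ x : ℝ, 0 ≤ x → x < xlam → lam < deriv mu x)
    (hA4b : ∀ x : ℝ, xlam ≤ x → deriv mu x ≤ lam)
    :
    ∃ g₁ g₂ : ℝ → ℝ,
      ContDiff ℝ 2 g₁ ∧ ContDiff ℝ 2 g₂ ∧
      (∀ x : ℝ, 0 ≤ x → 0 < g₁ x) ∧ (∀ x : ℝ, 0 ≤ x → 0 < g₂ x) ∧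
      (∀ x : ℝ, 0 ≤ x → Lop mu sig lam g₁ x = 0) ∧
      (∀ x : ℝ, 0 ≤ x → Lop mu sig lam g₂ x = 0) ∧
      (∀ a b : ℝ, (∀ x : ℝ, 0 ≤ x → a * g₁ x + b * g₂ x = 0) → a = 0 ∧ b = 0) ∧
      g₁ 0 = 1 ∧
      (∀ x : ℝ, 0 ≤ x → x < xlam → deriv g₁ x < 0) ∧
      deriv g₁ xlam = 0 ∧
      (∀ x : ℝ, xlam < x → 0 < deriv g₁ x) ∧
      (∀ x : ℝ, xlam ≤ x → 0 < deriv (deriv g₁) x) ∧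
      (∀ y₁ y₂ : ℝ, 0 < y₁ → 0 < y₂ → deriv (deriv g₁) y₁ = 0 →
        deriv (deriv g₁) y₂ = 0 → y₁ = y₂) ∧
      (∀ y : ℝ, 0 < y → deriv (deriv g₁) y = 0 → 0 < deriv (deriv (deriv g₁)) y) ∧
      StrictMonoOn g₂ (Ici (0:ℝ)) ∧ g₂ 0 = 1 ∧ 0 < deriv g₂ 0 := by
  have hmuc : Continuous mu := hA2mu.continuous
  have hsigc : Continuous sig := hA2sig.continuous
  let m : ℝ → ℝ := fun x => mu (max x 0)
  let S : ℝ → ℝ := fun x => sig (max x 0) ^ 2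
  have hm : ∀ x, 0 ≤ x → m x = mu x := fun x hx => by simp [m, hx]
  have hS : ∀ x, 0 ≤ x → S x = sig x ^ 2 := fun x hx => by simp [S, hx]
  have hmc : Continuous m := hmuc.comp (by fun_prop)
  have hSc : Continuous S := (hsigc.comp (by fun_prop)).pow 2
  have hS0 : ∀ x, 0 < S x := fun x => hA3 _ (le_max_right _ _)
  have hac : Continuous fun x => 2 * m x / S x :=
    (continuous_const.mul hmc).div hSc fun x => (hS0 x).ne'
  let P : ℝ → ℝ := fun x => Real.exp (∫ t in 0..x, 2 * m t / S t)
  have hP0 : ∀ x, 0 < P x := fun x => Real.exp_pos _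
  have hPd : ∀ x, HasDerivAt P (P x * (2 * m x / S x)) x := fun x =>
    (hac.integral_hasStrictDerivAt 0 x).hasDerivAt.exp
  have hPc : Continuous P := continuous_iff_continuousAt.2 fun x => (hPd x).continuousAt
  let Q : ℝ → ℝ := fun x => 2 * lam * P x / S x
  have hQ0 : ∀ x, 0 < Q x := fun x => by
    have := hP0 x
    have := hS0 x
    positivity
  have hQc : Continuous Q := (continuous_const.mul hPc).div hSc fun x => (hS0 x).ne'
  have hd1 : ∀ {g v : ℝ → ℝ}, (∀ x, HasDerivAt g (v x / P x) x) →
      deriv g = fun x => v x / P x := fun hg => funext fun x => (hg x).deriv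
  have hd2 : ∀ {g v : ℝ → ℝ}, (∀ x, HasDerivAt g (v x / P x) x) →
      (∀ x, HasDerivAt v (Q x * g x) x) →
      deriv (deriv g) = fun x => (2 * lam * P x * g x - 2 * m x * v x) / (S x * P x) := by
    intro g v hg hv
    rw [hd1 hg]
    funext x
    rw [((hv x).fun_div (hPd x) (hP0 x).ne').deriv]
    have := (hP0 x).ne'
    have := (hS0 x).ne'
    simp only [Q]
    field_simp
  have hsmooth : ∀ {g v : ℝ → ℝ}, (∀ x, HasDerivAt g (v x / P x) x) →
      (∀ x, HasDerivAt v (Q x * g x) x) → ContDiff ℝ 2 g := by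
    intro g v hg hv
    have hgc : Continuous g := continuous_iff_continuousAt.2 fun x => (hg x).continuousAt
    have hvc : Continuous v := continuous_iff_continuousAt.2 fun x => (hv x).continuousAt
    rw [show (2 : WithTop ℕ∞) = 1 + 1 by norm_num, contDiff_succ_iff_deriv]
    refine ⟨fun x => (hg x).differentiableAt, by simp, contDiff_one_iff_deriv.2 ⟨?_, ?_⟩⟩
    · rw [hd1 hg]
      exact fun x => ((hv x).fun_div (hPd x) (hP0 x).ne').differentiableAt
    · rw [hd2 hg hv]
      exact (by fun_prop : Continuous _).div (hSc.mul hPc) fun x =>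
        (mul_pos (hS0 x) (hP0 x)).ne'
  have hLop : ∀ {g v : ℝ → ℝ}, (∀ x, HasDerivAt g (v x / P x) x) →
      (∀ x, HasDerivAt v (Q x * g x) x) → ∀ x, 0 ≤ x → Lop mu sig lam g x = 0 := by
    intro g v hg hv x hx
    have := (hP0 x).ne'
    have := (hS0 x).ne'
    rw [Lop, ← hm x hx, ← hS x hx, hd2 hg hv, hd1 hg]
    field_simp
    ring
  -- The solution with a critical point at `xlam`, before normalization.
  obtain ⟨G, V, hG0, hV0, hG, hV⟩ := exists_sturmLiouville_solution hPc hQc hP0 xlam 1 0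
  have hGpos : ∀ x, 0 < G x := fun x => (le_total xlam x).elim
    (sturmLiouville_pos_right hP0 hQ0 hG hV (hG0 ▸ one_pos) hV0.ge)
    (sturmLiouville_pos_left hP0 hQ0 hG hV (hG0 ▸ one_pos) hV0.le)
  obtain ⟨g, v, hg0, hv0, hgpos, hg, hv⟩ : ∃ g v : ℝ → ℝ, g 0 = 1 ∧ v xlam = 0 ∧
      (∀ x, 0 < g x) ∧ (∀ x, HasDerivAt g (v x / P x) x) ∧
      ∀ x, HasDerivAt v (Q x * g x) x := by
    refine ⟨fun x => G x / G 0, fun x => V x / G 0, div_self (hGpos 0).ne', by simp [hV0],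
      fun x => div_pos (hGpos x) (hGpos 0), fun x => ?_, fun x => ?_⟩
    · rw [div_right_comm]
      exact (hG x).div_const _
    · rw [← mul_div_assoc]
      exact (hV x).div_const _
  have hvm : StrictMono v := strictMono_of_hasDerivAt_pos hv fun x => mul_pos (hQ0 x) (hgpos x)
  obtain ⟨f, w, hf0, hw0, hf, hw⟩ := exists_sturmLiouville_solution hPc hQc hP0 0 1 1
  have hfpos : ∀ x, 0 ≤ x → 0 < f x := fun x hx =>
    sturmLiouville_pos_right hP0 hQ0 hf hw (hf0 ▸ one_pos) (by rw [hw0]; exact zero_le_one) hx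
  have hwpos : ∀ x, 0 ≤ x → 0 < w x := fun x hx => by
    have : MonotoneOn w (Ici 0) :=
      monotoneOn_of_hasDerivWithinAt_nonneg (convex_Ici 0)
        (fun x _ => (hw x).continuousAt.continuousWithinAt)
        (fun x _ => (hw x).hasDerivWithinAt) fun x hx =>
          (mul_pos (hQ0 x) (hfpos x (interior_subset hx))).le
    have := this self_mem_Ici hx hx
    linarith
  -- The numerator of the second derivative of `g`.
  let h : ℝ → ℝ := fun x => 2 * lam * P x * g x - 2 * mu x * v x
  have hh : ∀ x, 0 < x → HasDerivAt h (2 * (lam - deriv mu x) * v x) x := by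
    intro x hx
    have hmud := (hA2mu.differentiable one_ne_zero x).hasDerivAt
    convert! (((hPd x).const_mul (2 * lam)).mul (hg x)).sub
      ((hmud.const_mul 2).mul (hv x)) using 1
    have := (hP0 x).ne'
    have := (hS0 x).ne'
    simp only [Q, hm x hx.le]
    field_simp
    ring
  have hgc : Continuous g := continuous_iff_continuousAt.2 fun x => (hg x).continuousAt
  have hvc : Continuous v := continuous_iff_continuousAt.2 fun x => (hv x).continuousAt
  have hhc : Continuous h := by fun_prop
  have hg2 : ∀ x, 0 ≤ x → deriv (deriv g) x = h x / (sig x ^ 2 * P x) := by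
    intro x hx
    simp only [hd2 hg hv, h, hm x hx, hS x hx]
  have hden : ∀ x, 0 ≤ x → 0 < sig x ^ 2 * P x := fun x hx => mul_pos (hA3 x hx) (hP0 x)
  have hhpos : ∀ x, xlam ≤ x → 0 < h x := by
    intro x hx
    have hmono : MonotoneOn h (Ici xlam) := by
      refine monotoneOn_of_hasDerivWithinAt_nonneg (convex_Ici xlam) hhc.continuousOn
        (fun x hx => (hh x ?_).hasDerivWithinAt) fun x hx => ?_
      all_goals rw [interior_Ici, mem_Ioi] at hx
      · exact hxlam.trans_lt hx
      · have := hA4b x hx.le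
        have := hvm hx
        exact mul_nonneg (by linarith) (by linarith)
    refine lt_of_lt_of_le ?_ (hmono self_mem_Ici hx hx)
    have := hP0 xlam
    have := hgpos xlam
    simp only [h, hv0, mul_zero, sub_zero]
    positivity
  have hhd : ∀ x, 0 < x → x < xlam → 0 < 2 * (lam - deriv mu x) * v x := by
    intro x h0 hx
    have := hA4a x h0.le hx
    have := hvm hx
    exact mul_pos_of_neg_of_neg (by linarith) (by linarith)
  have hhm : StrictMonoOn h (Icc 0 xlam) := by
    refine strictMonoOn_of_hasDerivWithinAt_pos (convex_Icc 0 xlam) hhc.continuousOn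
      (fun x hx => (hh x ?_).hasDerivWithinAt) fun x hx => ?_
    all_goals rw [interior_Icc, mem_Ioo] at hx
    · exact hx.1
    · exact hhd x hx.1 hx.2
  have hinfl : ∀ y, 0 < y → deriv (deriv g) y = 0 → h y = 0 ∧ y < xlam := by
    intro y hy hy0
    rw [hg2 y hy.le, div_eq_zero_iff, or_iff_left (hden y hy.le).ne'] at hy0
    exact ⟨hy0, not_le.1 fun hle => (hhpos y hle).ne' hy0⟩
  refine ⟨g, f, hsmooth hg hv, hsmooth hf hw, fun x _ => hgpos x, hfpos, hLop hg hv, hLop hf hw,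
    ?_, hg0, ?_, ?_, ?_, ?_, ?_, ?_, ?_, hf0, ?_⟩
  · intro a b hab
    have h1 := hab 0 le_rfl
    have h2 : a * (v 0 / P 0) + b * (w 0 / P 0) = 0 :=
      (uniqueDiffWithinAt_Ici (0 : ℝ)).eq_deriv _
        (((hg 0).const_mul a).add ((hf 0).const_mul b)).hasDerivWithinAt
        ((hasDerivWithinAt_const 0 (Ici 0) (0 : ℝ)).congr (fun x hx => hab x hx) h1)
    have h3 : v 0 ≤ 0 := (hvm.monotone hxlam).trans_eq hv0
    rw [hw0, mul_div_assoc', mul_div_assoc', ← add_div, div_eq_zero_iff,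
      or_iff_left (hP0 0).ne'] at h2
    rw [hg0, hf0] at h1
    have h4 : a * (v 0 - 1) = 0 := by linear_combination h2 - h1
    have ha : a = 0 := (mul_eq_zero.1 h4).resolve_right (by linarith)
    exact ⟨ha, by linarith⟩
  · intro x _ hx
    rw [(hg x).deriv]
    exact div_neg_of_neg_of_pos (hv0 ▸ hvm hx) (hP0 x)
  · rw [(hg xlam).deriv, hv0, zero_div]
  · intro x hx
    rw [(hg x).deriv]
    exact div_pos (hv0 ▸ hvm hx) (hP0 x)
  · intro x hx
    rw [hg2 x (hxlam.trans hx)]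
    exact div_pos (hhpos x hx) (hden x (hxlam.trans hx))
  · intro y₁ y₂ h₁ h₂ hy₁ hy₂
    obtain ⟨hz₁, hl₁⟩ := hinfl y₁ h₁ hy₁
    obtain ⟨hz₂, hl₂⟩ := hinfl y₂ h₂ hy₂
    exact hhm.injOn ⟨h₁.le, hl₁.le⟩ ⟨h₂.le, hl₂.le⟩ (hz₁.trans hz₂.symm)
  · intro y hy hy0
    obtain ⟨hz, hl⟩ := hinfl y hy hy0
    have hev : deriv (deriv g) =ᶠ[𝓝 y] fun x => h x / (sig x ^ 2 * P x) :=
      (eventually_gt_nhds hy).mono fun x hx => hg2 x hx.le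
    have hsd := (hA2sig.differentiable one_ne_zero y).hasDerivAt
    rw [hev.deriv_eq, ((hh y hy).fun_div ((hsd.fun_pow 2).fun_mul (hPd y)) (hden y hy.le).ne').deriv,
      hz, zero_mul, sub_zero]
    have := hden y hy.le
    have := hhd y hy hl
    positivity
  · refine strictMonoOn_of_hasDerivWithinAt_pos (convex_Ici 0)
      (fun x _ => (hf x).continuousAt.continuousWithinAt)
      (fun x _ => (hf x).hasDerivWithinAt) fun x hx =>
        div_pos (hwpos x (interior_subset hx)) (hP0 x)
  · rw [(hf 0).deriv]
    exact div_pos (hwpos 0 le_rfl) (hP0 0)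
end

section
/- Assume W(x) > 0 for all x ≥ 0, that g₁″(0) < 0 (so that z₀ > 0), and that there is x₁* ∈ (0,x_λ] such that g″(x) = g₂″(x) − g₁″(x) > 0 for all x ∈ [0,x₁*) and g″(x₁*) = 0. Then z₀ < x₁*. -/
open Set Filter Topology

theorem stmt_1    (lam k K C xlam : ℝ) (mu sig : ℝ → ℝ)
    (hlam : 0 < lam) (hk : 0 < k) (hK : 0 < K) (hC : 0 < C)
    (hA1 : ∀ x : ℝ, 0 ≤ x → |mu x| + |sig x| ≤ C * (1 + x))
    (hA2mu : ContDiff ℝ 1 mu) (hA2sig : ContDiff ℝ 1 sig)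
    (hA2muL : ∃ M : NNReal, LipschitzWith M mu)
    (hA2sigL : ∃ M : NNReal, LipschitzWith M sig)
    (hA2muL' : ∃ M : NNReal, LipschitzWith M (deriv mu))
    (hA2sigL' : ∃ M : NNReal, LipschitzWith M (deriv sig))
    (hA3 : ∀ x : ℝ, 0 ≤ x → 0 < (sig x)^2)
    (hxlam : 0 ≤ xlam)
    (hA4a : ∀ x : ℝ, 0 ≤ x → x < xlam → lam < deriv mu x)
    (hA4b : ∀ x : ℝ, xlam ≤ x → deriv mu x ≤ lam)
    (g₁ g₂ : ℝ → ℝ)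
    (hg₁C : ContDiff ℝ 2 g₁) (hg₂C : ContDiff ℝ 2 g₂)
    (hg₁pos : ∀ x : ℝ, 0 ≤ x → 0 < g₁ x) (hg₂pos : ∀ x : ℝ, 0 ≤ x → 0 < g₂ x)
    (hg₁L : ∀ x : ℝ, 0 ≤ x → Lop mu sig lam g₁ x = 0)
    (hg₂L : ∀ x : ℝ, 0 ≤ x → Lop mu sig lam g₂ x = 0)
    (hg₁z : g₁ 0 = 1) (hg₂z : g₂ 0 = 1)
    (hg₁d : ∀ x : ℝ, 0 ≤ x → x < xlam → deriv g₁ x < 0)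
    (hg₁dx : deriv g₁ xlam = 0)
    (hg₁di : ∀ x : ℝ, xlam < x → 0 < deriv g₁ x)
    (hg₁dd : ∀ x : ℝ, xlam ≤ x → 0 < deriv (deriv g₁) x)
    (hg₂mono : StrictMonoOn g₂ (Ici (0:ℝ)))
    (hg₂d0 : 0 < deriv g₂ 0)
    (z₀ : ℝ) (hz₀ge : 0 ≤ z₀) (hz₀lt : z₀ < xlam)
    (hz₀eq : 0 ≤ deriv (deriv g₁) 0 → z₀ = 0)
    (hz₀a : ∀ x : ℝ, 0 < x → x < z₀ → deriv (deriv g₁) x < 0)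
    (hz₀b : ∀ x : ℝ, z₀ < x → x < xlam → 0 < deriv (deriv g₁) x)
    (hW : ∀ x : ℝ, 0 ≤ x → 0 < Wron g₁ g₂ x)
    (hg₁dd0 : deriv (deriv g₁) 0 < 0) (hz₀pos : 0 < z₀)
    (x₁ : ℝ) (hx₁a : 0 < x₁) (hx₁b : x₁ ≤ xlam)
    (hx₁c : ∀ x : ℝ, 0 ≤ x → x < x₁ → 0 < gb'' g₁ g₂ 1 x)
    (hx₁d : gb'' g₁ g₂ 1 x₁ = 0) :
    z₀ < x₁ := by
  by_contra! hle
  have hx₁lt : x₁ < xlam := hle.trans_lt hz₀lt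
  have hcont : Continuous (deriv (deriv g₁)) :=
    (ContDiff.iterate_deriv' 0 2 (by simpa using hg₁C)).continuous
  have hconcave : deriv (deriv g₁) x₁ ≤ 0 := by
    have hsub : closure (Ioo 0 z₀) ⊆ {x | deriv (deriv g₁) x ≤ 0} :=
      closure_minimal (fun x hx => (hz₀a x hx.1 hx.2).le)
        (isClosed_le hcont continuous_const)
    rw [closure_Ioo hz₀pos.ne] at hsub
    exact hsub ⟨hx₁a.le, hle⟩
  have hg₁lt : g₁ x₁ < 1 := by
    have hanti : StrictAntiOn g₁ (Icc 0 x₁) :=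
      strictAntiOn_of_deriv_neg (convex_Icc 0 x₁) hg₁C.continuous.continuousOn fun x hx => by
        rw [interior_Icc] at hx
        exact hg₁d x hx.1.le (hx.2.trans hx₁lt)
    simpa [hg₁z] using hanti (left_mem_Icc.2 hx₁a.le) (right_mem_Icc.2 hx₁a.le) hx₁a
  have hg₂gt : 1 < g₂ x₁ := by
    simpa [hg₂z] using hg₂mono self_mem_Ici hx₁a.le hx₁a
  have hg₂d : 0 ≤ deriv g₂ x₁ := by
    rw [← derivWithin_of_mem_nhds (Ici_mem_nhds hx₁a)]
    exact hg₂mono.monotoneOn.derivWithin_nonneg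
  have hg₁neg := hg₁d x₁ hx₁a.le hx₁lt
  have h₁ := hg₁L x₁ hx₁a.le
  have h₂ := hg₂L x₁ hx₁a.le
  simp only [Lop] at h₁ h₂
  have hdd : deriv (deriv g₂) x₁ = deriv (deriv g₁) x₁ := by
    simp only [gb''] at hx₁d
    linarith
  rw [hdd] at h₂
  have hdrift : 0 < mu x₁ * (deriv g₂ x₁ - deriv g₁ x₁) := by
    have : mu x₁ * (deriv g₂ x₁ - deriv g₁ x₁) = lam * (g₂ x₁ - g₁ x₁) := by linarith
    rw [this]
    exact mul_pos hlam (by linarith)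
  have hmu : 0 < mu x₁ := pos_of_mul_pos_left hdrift (by linarith)
  have hdiff := mul_nonpos_of_nonneg_of_nonpos (hA3 x₁ hx₁a.le).le hconcave
  have hmul := mul_neg_of_pos_of_neg hmu hg₁neg
  have hpot := mul_pos hlam (hg₁pos x₁ hx₁a.le)
  linarith
end

section
/- (a) For every x ∈ [0,z̲) at which g₁″(x) ≠ 0 and g′(x;h(x)) ≠ 0, one has γ(h(x),x) < 0. (b) At x = z̲ one has g₁″(z̲) > 0 and g′(z̲;h(z̲)) > 0, so γ(h(z̲),z̲) is well defined, and γ(h(z̲),z̲) = 0. -/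
open Set Filter Topology

/-- For two solutions of `Lg = 0`, the Wronskian of the derivatives is proportional to the
Wronskian. -/
theorem half_sq_mul_wron_deriv {mu sig : ℝ → ℝ} {lam : ℝ} {g₁ g₂ : ℝ → ℝ} {x : ℝ}
    (h₁ : Lop mu sig lam g₁ x = 0) (h₂ : Lop mu sig lam g₂ x = 0) :
    (1/2) * (sig x)^2 * (deriv (deriv g₁) x * deriv g₂ x - deriv (deriv g₂) x * deriv g₁ x) =
      lam * Wron g₁ g₂ x := by
  unfold Lop at h₁ h₂
  unfold Wron
  linear_combination deriv g₂ x * h₁ - deriv g₁ x * h₂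

/-- With `β = h(x)` the second derivative of `g(·; β)` vanishes at `x`, so `Lg = 0` is
first order there. -/
theorem mu_mul_gb'_hfun {mu sig : ℝ → ℝ} {lam : ℝ} {g₁ g₂ : ℝ → ℝ} {x : ℝ}
    (h₁ : Lop mu sig lam g₁ x = 0) (h₂ : Lop mu sig lam g₂ x = 0)
    (hd : deriv (deriv g₁) x ≠ 0) :
    mu x * gb' g₁ g₂ (hfun g₁ g₂ x) x = lam * gb g₁ g₂ (hfun g₁ g₂ x) x := by
  have hh : hfun g₁ g₂ x * deriv (deriv g₁) x = deriv (deriv g₂) x := div_mul_cancel₀ _ hd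
  unfold Lop at h₁ h₂
  unfold gb gb'
  linear_combination h₂ - hfun g₁ g₂ x * h₁ + (1/2) * (sig x)^2 * hh

theorem lam_mul_gam_hfun {mu sig : ℝ → ℝ} {lam : ℝ} {g₁ g₂ : ℝ → ℝ} {x : ℝ} (k K : ℝ)
    (h₁ : Lop mu sig lam g₁ x = 0) (h₂ : Lop mu sig lam g₂ x = 0)
    (hd : deriv (deriv g₁) x ≠ 0) (hg : gb' g₁ g₂ (hfun g₁ g₂ x) x ≠ 0) :
    lam * gam k K g₁ g₂ (hfun g₁ g₂ x) x = mu x * k - lam * (k * x - K) := by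
  have hq : lam * (gb g₁ g₂ (hfun g₁ g₂ x) x / gb' g₁ g₂ (hfun g₁ g₂ x) x) = mu x := by
    rw [← mul_div_assoc, ← mu_mul_gb'_hfun h₁ h₂ hd, mul_div_cancel_right₀ _ hg]
  unfold gam
  linear_combination k * hq

theorem gb'_hfun_pos {mu sig : ℝ → ℝ} {lam : ℝ} {g₁ g₂ : ℝ → ℝ} {x : ℝ}
    (h₁ : Lop mu sig lam g₁ x = 0) (h₂ : Lop mu sig lam g₂ x = 0)
    (hlam : 0 < lam) (hW : 0 < Wron g₁ g₂ x) (hd : 0 < deriv (deriv g₁) x) :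
    0 < gb' g₁ g₂ (hfun g₁ g₂ x) x := by
  have hprod : 0 < (1/2) * (sig x)^2 *
      (deriv (deriv g₁) x * deriv g₂ x - deriv (deriv g₂) x * deriv g₁ x) := by
    rw [half_sq_mul_wron_deriv h₁ h₂]
    exact mul_pos hlam hW
  have hnum := pos_of_mul_pos_right hprod (by positivity)
  have heq : gb' g₁ g₂ (hfun g₁ g₂ x) x =
      (deriv (deriv g₁) x * deriv g₂ x - deriv (deriv g₂) x * deriv g₁ x) /
        deriv (deriv g₁) x := by
    unfold gb' hfun
    field_simp
  rw [heq]
  exact div_pos hnum hd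

theorem stmt_9    (lam k K C xlam : ℝ) (mu sig : ℝ → ℝ)
    (hlam : 0 < lam) (hk : 0 < k) (hK : 0 < K) (hC : 0 < C)
    (hA1 : ∀ x : ℝ, 0 ≤ x → |mu x| + |sig x| ≤ C * (1 + x))
    (hA2mu : ContDiff ℝ 1 mu) (hA2sig : ContDiff ℝ 1 sig)
    (hA2muL : ∃ M : NNReal, LipschitzWith M mu)
    (hA2sigL : ∃ M : NNReal, LipschitzWith M sig)
    (hA2muL' : ∃ M : NNReal, LipschitzWith M (deriv mu))
    (hA2sigL' : ∃ M : NNReal, LipschitzWith M (deriv sig))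
    (hA3 : ∀ x : ℝ, 0 ≤ x → 0 < (sig x)^2)
    (hxlam : 0 ≤ xlam)
    (hA4a : ∀ x : ℝ, 0 ≤ x → x < xlam → lam < deriv mu x)
    (hA4b : ∀ x : ℝ, xlam ≤ x → deriv mu x ≤ lam)
    (g₁ g₂ : ℝ → ℝ)
    (hg₁C : ContDiff ℝ 2 g₁) (hg₂C : ContDiff ℝ 2 g₂)
    (hg₁pos : ∀ x : ℝ, 0 ≤ x → 0 < g₁ x) (hg₂pos : ∀ x : ℝ, 0 ≤ x → 0 < g₂ x)
    (hg₁L : ∀ x : ℝ, 0 ≤ x → Lop mu sig lam g₁ x = 0)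
    (hg₂L : ∀ x : ℝ, 0 ≤ x → Lop mu sig lam g₂ x = 0)
    (hg₁z : g₁ 0 = 1) (hg₂z : g₂ 0 = 1)
    (hg₁d : ∀ x : ℝ, 0 ≤ x → x < xlam → deriv g₁ x < 0)
    (hg₁dx : deriv g₁ xlam = 0)
    (hg₁di : ∀ x : ℝ, xlam < x → 0 < deriv g₁ x)
    (hg₁dd : ∀ x : ℝ, xlam ≤ x → 0 < deriv (deriv g₁) x)
    (hg₂mono : StrictMonoOn g₂ (Ici (0:ℝ)))
    (hg₂d0 : 0 < deriv g₂ 0)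
    (z₀ : ℝ) (hz₀ge : 0 ≤ z₀) (hz₀lt : z₀ < xlam)
    (hz₀eq : 0 ≤ deriv (deriv g₁) 0 → z₀ = 0)
    (hz₀a : ∀ x : ℝ, 0 < x → x < z₀ → deriv (deriv g₁) x < 0)
    (hz₀b : ∀ x : ℝ, z₀ < x → x < xlam → 0 < deriv (deriv g₁) x)
    (hW : ∀ x : ℝ, 0 ≤ x → 0 < Wron g₁ g₂ x)
    (hgd : ∀ x : ℝ, 0 ≤ x → 0 < gb' g₁ g₂ 1 x)
    (x₁ : ℝ) (hx₁a : z₀ < x₁) (hx₁b : x₁ ≤ xlam)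
    (hx₁c : ∀ x : ℝ, 0 ≤ x → x < x₁ → 0 < gb'' g₁ g₂ 1 x)
    (hx₁d : gb'' g₁ g₂ 1 x₁ = 0)
    (hmux : 0 < mu xlam * k - lam * (k * xlam - K))
    (z : ℝ) (hza : x₁ < z) (hzb : z < xlam)
    (hzc : mu z * k - lam * (k * z - K) = 0)
    (hzd : ∀ x : ℝ, 0 ≤ x → x < z → mu x * k - lam * (k * x - K) < 0)
    :
    (∀ x : ℝ, 0 ≤ x → x < z → deriv (deriv g₁) x ≠ 0 →
      gb' g₁ g₂ (hfun g₁ g₂ x) x ≠ 0 →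
      gam k K g₁ g₂ (hfun g₁ g₂ x) x < 0) ∧
    0 < deriv (deriv g₁) z ∧
    0 < gb' g₁ g₂ (hfun g₁ g₂ z) z ∧
    gam k K g₁ g₂ (hfun g₁ g₂ z) z = 0 := by
  have hz : 0 ≤ z := by linarith
  have hdz : 0 < deriv (deriv g₁) z := hz₀b z (by linarith) hzb
  have hgz := gb'_hfun_pos (hg₁L z hz) (hg₂L z hz) hlam (hW z hz) hdz
  refine ⟨fun x hx hxz hd hg => ?_, hdz, hgz, ?_⟩
  · refine neg_of_mul_neg_right ?_ hlam.le
    rw [lam_mul_gam_hfun k K (hg₁L x hx) (hg₂L x hx) hd hg]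
    exact hzd x hx hxz
  · refine (mul_eq_zero.mp ?_).resolve_left hlam.ne'
    rw [lam_mul_gam_hfun k K (hg₁L z hz) (hg₂L z hz) hdz.ne' hgz.ne', hzc]
end

section
/- There is a unique continuously differentiable (on the open interval), strictly decreasing function u₁ : [h(z̲),1] → [ū*,z̲] such that γ(β,u₁(β)) = 0 for every β ∈ [h(z̲),1]. Moreover ū* < u₁(β) < h₋⁻¹(β) for β ∈ (h(z̲),1), u₁(h(z̲)) = z̲, and u₁(1) = ū*. -/
open Set Filter Topology

/-- The inverse of a function on `[a, b]` with negative derivative on `(a, b)` is continuous and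
strictly decreasing, and it is `C¹` in the interior. -/
theorem exists_contDiffOn_inverse_of_deriv_neg {B B' : ℝ → ℝ} {a b : ℝ} (hab : a ≤ b)
    (hB : ∀ x ∈ Icc a b, HasDerivAt B (B' x) x) (hB' : ContinuousOn B' (Ioo a b))
    (hneg : ∀ x ∈ Ioo a b, B' x < 0) :
    StrictAntiOn B (Icc a b) ∧
      ∃ u : ℝ → ℝ, ContinuousOn u (Icc (B b) (B a)) ∧ ContDiffOn ℝ 1 u (Ioo (B b) (B a)) ∧
        StrictAntiOn u (Icc (B b) (B a)) ∧ MapsTo u (Icc (B b) (B a)) (Icc a b) ∧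
        ∀ β ∈ Icc (B b) (B a), B (u β) = β := by
  have hBc : ContinuousOn B (Icc a b) := fun x hx => (hB x hx).continuousAt.continuousWithinAt
  have hanti : StrictAntiOn B (Icc a b) := by
    refine strictAntiOn_of_deriv_neg (convex_Icc a b) hBc fun x hx => ?_
    rw [interior_Icc] at hx
    rw [(hB x (Ioo_subset_Icc_self hx)).deriv]
    exact hneg x hx
  have hsurj : SurjOn B (Icc a b) (Icc (B b) (B a)) := intermediate_value_Icc' hab hBc
  set u := Function.invFunOn B (Icc a b)
  have hmaps : MapsTo u (Icc (B b) (B a)) (Icc a b) := hsurj.mapsTo_invFunOn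
  have hright : ∀ β ∈ Icc (B b) (B a), B (u β) = β := hsurj.rightInvOn_invFunOn
  have huanti : StrictAntiOn u (Icc (B b) (B a)) := by
    intro x hx y hy hxy
    rw [← hanti.lt_iff_gt (hmaps hx) (hmaps hy), hright x hx, hright y hy]
    exact hxy
  have huc : ContinuousOn u (Icc (B b) (B a)) := by
    refine continuousOn_iff_isClosed.2 fun t ht => ⟨B '' (Icc a b ∩ t),
      ((isCompact_Icc.inter_right ht).image_of_continuousOn
        (hBc.mono inter_subset_left)).isClosed, ?_⟩
    ext β
    constructor
    · rintro ⟨hβt, hβ⟩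
      exact ⟨⟨u β, ⟨hmaps hβ, hβt⟩, hright β hβ⟩, hβ⟩
    · rintro ⟨⟨x, ⟨hx, hxt⟩, rfl⟩, hβ⟩
      have hux : u (B x) = x := hanti.injOn (hmaps hβ) hx (hright _ hβ)
      exact ⟨by rwa [mem_preimage, hux], hβ⟩
  have humaps : MapsTo u (Ioo (B b) (B a)) (Ioo a b) := by
    intro β hβ
    have hβ' := Ioo_subset_Icc_self hβ
    have hmem := hmaps hβ'
    refine ⟨lt_of_le_of_ne hmem.1 fun h => ?_, lt_of_le_of_ne hmem.2 fun h => ?_⟩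
    · have := hright β hβ'
      rw [← h] at this
      exact hβ.2.ne' this
    · have := hright β hβ'
      rw [h] at this
      exact hβ.1.ne this
  have hderiv : ∀ β ∈ Ioo (B b) (B a), HasDerivAt u (B' (u β))⁻¹ β := by
    intro β hβ
    refine HasDerivAt.of_local_left_inverse (huc.continuousAt (Icc_mem_nhds hβ.1 hβ.2))
      (hB _ (hmaps (Ioo_subset_Icc_self hβ))) (hneg _ (humaps hβ)).ne ?_
    filter_upwards [Icc_mem_nhds hβ.1 hβ.2] with y hy using hright y hy
  refine ⟨hanti, u, huc, ?_, huanti, hmaps, hright⟩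
  rw [contDiffOn_one_iff_derivWithin isOpen_Ioo.uniqueDiffOn]
  refine ⟨fun β hβ => (hderiv β hβ).differentiableAt.differentiableWithinAt, ?_⟩
  refine ContinuousOn.congr (f := fun β => (B' (u β))⁻¹) ?_ fun β hβ => ?_
  · exact (hB'.comp (huc.mono Ioo_subset_Icc_self) humaps).inv₀
      fun β hβ => (hneg _ (humaps hβ)).ne
  · rw [derivWithin_of_isOpen isOpen_Ioo hβ, (hderiv β hβ).deriv]

/-- The numerator of `gam` over the common denominator, for a single function `g`; `gam` vanishes
when `gamNum k K g₂ = β * gamNum k K g₁`. -/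
noncomputable def gamNum (k K : ℝ) (g : ℝ → ℝ) (x : ℝ) : ℝ := k * g x - (k * x - K) * deriv g x

theorem hasDerivAt_gamNum {g : ℝ → ℝ} (hg : ContDiff ℝ 2 g) (k K x : ℝ) :
    HasDerivAt (gamNum k K g) (-(k * x - K) * deriv (deriv g) x) x := by
  have hg1 : HasDerivAt g (deriv g x) x := (hg.differentiable (by norm_num) x).hasDerivAt
  have hg2 : HasDerivAt (deriv g) (deriv (deriv g) x) x :=
    ((hg.differentiable_deriv_two) x).hasDerivAt
  have hlin : HasDerivAt (fun x : ℝ => k * x - K) k x := by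
    simpa using ((hasDerivAt_id x).const_mul k).sub_const K
  refine ((hg1.const_mul k).sub (hlin.mul hg2)).congr_deriv ?_
  ring

theorem gamNum_sub_mul_eq_zero {k K β x : ℝ} {g₁ g₂ : ℝ → ℝ} (hx : K < k * x)
    (h : gam k K g₁ g₂ β x = 0) : gamNum k K g₂ x - β * gamNum k K g₁ x = 0 := by
  have hne : gb' g₁ g₂ β x ≠ 0 := by
    intro h0
    simp only [gam, h0, div_zero] at h
    linarith
  unfold gam at h
  field_simp at h
  simp only [gamNum]
  simp only [gb, gb'] at h
  linarith

theorem gamNum_mul_deriv_sub (k K x : ℝ) (g₁ g₂ : ℝ → ℝ) :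
    deriv g₂ x * gamNum k K g₁ x - gamNum k K g₂ x * deriv g₁ x = k * Wron g₁ g₂ x := by
  simp only [gamNum, Wron]
  ring

theorem gam_eq_zero_of_gamNum {k K β x : ℝ} {g₁ g₂ : ℝ → ℝ} (hk : 0 < k)
    (hW : 0 < Wron g₁ g₂ x) (h : gamNum k K g₂ x - β * gamNum k K g₁ x = 0) :
    gam k K g₁ g₂ β x = 0 := by
  have hne : gb' g₁ g₂ β x ≠ 0 := by
    intro h0
    have h1 := gamNum_mul_deriv_sub k K x g₁ g₂
    have h2 : deriv g₂ x * gamNum k K g₁ x - gamNum k K g₂ x * deriv g₁ x = 0 := by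
      simp only [gb'] at h0
      linear_combination gamNum k K g₁ x * h0 - deriv g₁ x * h
    exact (mul_pos hk hW).ne' (h1 ▸ h2)
  unfold gam
  field_simp
  simp only [gamNum] at h
  simp only [gb, gb']
  linarith

theorem half_mul_deriv_deriv_of_Lop_eq_zero {mu sig g : ℝ → ℝ} {lam x : ℝ}
    (h : Lop mu sig lam g x = 0) (k K : ℝ) :
    1 / 2 * k * sig x ^ 2 * deriv (deriv g) x =
      lam * gamNum k K g x - (mu x * k - lam * (k * x - K)) * deriv g x := by
  simp only [Lop] at h
  simp only [gamNum]
  linear_combination k * h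

theorem half_mul_gamNum_cross_of_Lop_eq_zero {mu sig g₁ g₂ : ℝ → ℝ} {lam x : ℝ}
    (h₁ : Lop mu sig lam g₁ x = 0) (h₂ : Lop mu sig lam g₂ x = 0) (k K : ℝ) :
    1 / 2 * k * sig x ^ 2 * (deriv (deriv g₂) x * gamNum k K g₁ x -
        gamNum k K g₂ x * deriv (deriv g₁) x) =
      -(mu x * k - lam * (k * x - K)) * (k * Wron g₁ g₂ x) := by
  rw [← gamNum_mul_deriv_sub k K]
  linear_combination gamNum k K g₁ x * half_mul_deriv_deriv_of_Lop_eq_zero h₂ k K -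
    gamNum k K g₂ x * half_mul_deriv_deriv_of_Lop_eq_zero h₁ k K

theorem stmt_11    (lam k K C xlam : ℝ) (mu sig : ℝ → ℝ)
    (hlam : 0 < lam) (hk : 0 < k) (hK : 0 < K) (hC : 0 < C)
    (hA1 : ∀ x : ℝ, 0 ≤ x → |mu x| + |sig x| ≤ C * (1 + x))
    (hA2mu : ContDiff ℝ 1 mu) (hA2sig : ContDiff ℝ 1 sig)
    (hA2muL : ∃ M : NNReal, LipschitzWith M mu)
    (hA2sigL : ∃ M : NNReal, LipschitzWith M sig)
    (hA2muL' : ∃ M : NNReal, LipschitzWith M (deriv mu))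
    (hA2sigL' : ∃ M : NNReal, LipschitzWith M (deriv sig))
    (hA3 : ∀ x : ℝ, 0 ≤ x → 0 < (sig x)^2)
    (hxlam : 0 ≤ xlam)
    (hA4a : ∀ x : ℝ, 0 ≤ x → x < xlam → lam < deriv mu x)
    (hA4b : ∀ x : ℝ, xlam ≤ x → deriv mu x ≤ lam)
    (g₁ g₂ : ℝ → ℝ)
    (hg₁C : ContDiff ℝ 2 g₁) (hg₂C : ContDiff ℝ 2 g₂)
    (hg₁pos : ∀ x : ℝ, 0 ≤ x → 0 < g₁ x) (hg₂pos : ∀ x : ℝ, 0 ≤ x → 0 < g₂ x)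
    (hg₁L : ∀ x : ℝ, 0 ≤ x → Lop mu sig lam g₁ x = 0)
    (hg₂L : ∀ x : ℝ, 0 ≤ x → Lop mu sig lam g₂ x = 0)
    (hg₁z : g₁ 0 = 1) (hg₂z : g₂ 0 = 1)
    (hg₁d : ∀ x : ℝ, 0 ≤ x → x < xlam → deriv g₁ x < 0)
    (hg₁dx : deriv g₁ xlam = 0)
    (hg₁di : ∀ x : ℝ, xlam < x → 0 < deriv g₁ x)
    (hg₁dd : ∀ x : ℝ, xlam ≤ x → 0 < deriv (deriv g₁) x)
    (hg₂mono : StrictMonoOn g₂ (Ici (0:ℝ)))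
    (hg₂d0 : 0 < deriv g₂ 0)
    (z₀ : ℝ) (hz₀ge : 0 ≤ z₀) (hz₀lt : z₀ < xlam)
    (hz₀eq : 0 ≤ deriv (deriv g₁) 0 → z₀ = 0)
    (hz₀a : ∀ x : ℝ, 0 < x → x < z₀ → deriv (deriv g₁) x < 0)
    (hz₀b : ∀ x : ℝ, z₀ < x → x < xlam → 0 < deriv (deriv g₁) x)
    (hW : ∀ x : ℝ, 0 ≤ x → 0 < Wron g₁ g₂ x)
    (hgd : ∀ x : ℝ, 0 ≤ x → 0 < gb' g₁ g₂ 1 x)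
    (x₁ : ℝ) (hx₁a : z₀ < x₁) (hx₁b : x₁ ≤ xlam)
    (hx₁c : ∀ x : ℝ, 0 ≤ x → x < x₁ → 0 < gb'' g₁ g₂ 1 x)
    (hx₁d : gb'' g₁ g₂ 1 x₁ = 0)
    (hmux : 0 < mu xlam * k - lam * (k * xlam - K))
    (z : ℝ) (hza : x₁ < z) (hzb : z < xlam)
    (hzc : mu z * k - lam * (k * z - K) = 0)
    (hzd : ∀ x : ℝ, 0 ≤ x → x < z → mu x * k - lam * (k * x - K) < 0)
    (ubar : ℝ) (hubar0 : 0 < ubar) (hubar1 : ubar < x₁)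
    (hubarg : gam k K g₁ g₂ 1 ubar = 0)
    (hinv : ℝ → ℝ)
    (hhinv : ∀ β : ℝ, hfun g₁ g₂ z ≤ β → β ≤ 1 →
      x₁ ≤ hinv β ∧ hinv β ≤ z ∧ hfun g₁ g₂ (hinv β) = β ∧
      (∀ y : ℝ, x₁ ≤ y → y ≤ z → hfun g₁ g₂ y = β → y = hinv β))
    :
    ∃ u₁ : ℝ → ℝ,
      (ContinuousOn u₁ (Icc (hfun g₁ g₂ z) 1) ∧
       ContDiffOn ℝ 1 u₁ (Ioo (hfun g₁ g₂ z) 1) ∧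
       StrictAntiOn u₁ (Icc (hfun g₁ g₂ z) 1) ∧
       (∀ β ∈ Icc (hfun g₁ g₂ z) 1, u₁ β ∈ Icc ubar z) ∧
       (∀ β ∈ Icc (hfun g₁ g₂ z) 1, gam k K g₁ g₂ β (u₁ β) = 0) ∧
       (∀ β ∈ Ioo (hfun g₁ g₂ z) 1, ubar < u₁ β ∧ u₁ β < hinv β) ∧
       u₁ (hfun g₁ g₂ z) = z ∧ u₁ 1 = ubar) ∧
      (∀ v : ℝ → ℝ,
        ContinuousOn v (Icc (hfun g₁ g₂ z) 1) →
        ContDiffOn ℝ 1 v (Ioo (hfun g₁ g₂ z) 1) →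
        StrictAntiOn v (Icc (hfun g₁ g₂ z) 1) →
        (∀ β ∈ Icc (hfun g₁ g₂ z) 1, v β ∈ Icc ubar z) →
        (∀ β ∈ Icc (hfun g₁ g₂ z) 1, gam k K g₁ g₂ β (v β) = 0) →
        EqOn v u₁ (Icc (hfun g₁ g₂ z) 1)) := by
  have hkubar : K < k * ubar := by
    have hmono : StrictMonoOn (gb g₁ g₂ 1) (Icc 0 ubar) := by
      have hd : ∀ x, HasDerivAt (gb g₁ g₂ 1) (gb' g₁ g₂ 1 x) x := fun x =>
        ((hg₂C.differentiable (by norm_num) x).hasDerivAt).sub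
          ((hg₁C.differentiable (by norm_num) x).hasDerivAt.const_mul 1)
      refine strictMonoOn_of_deriv_pos (convex_Icc 0 ubar)
        (fun x _ => (hd x).continuousAt.continuousWithinAt) fun x hx => ?_
      rw [interior_Icc] at hx
      rw [(hd x).deriv]
      exact hgd x hx.1.le
    have h0 := hmono (left_mem_Icc.2 hubar0.le) (right_mem_Icc.2 hubar0.le) hubar0
    have h1 : 0 < gb g₁ g₂ 1 ubar := by
      simpa [gb, hg₁z, hg₂z] using h0
    have h2 := mul_pos hk (div_pos h1 (hgd ubar hubar0.le))
    simp only [gam] at hubarg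
    linarith
  have huz : ubar < z := hubar1.trans hza
  have hkx : ∀ x, ubar ≤ x → K < k * x := fun x hx =>
    hkubar.trans_le (mul_le_mul_of_nonneg_left hx hk.le)
  have hN₁ : ∀ x ∈ Icc ubar z, 0 < gamNum k K g₁ x := by
    intro x hx
    have hx0 : 0 ≤ x := hubar0.le.trans hx.1
    have h1 := mul_pos hk (hg₁pos x hx0)
    have h2 := mul_neg_of_pos_of_neg (sub_pos.2 (hkx x hx.1))
      (hg₁d x hx0 (hx.2.trans_lt hzb))
    simp only [gamNum]
    linarith
  have hcross : ∀ x, ubar ≤ x → x < z →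
      0 < deriv (deriv g₂) x * gamNum k K g₁ x - gamNum k K g₂ x * deriv (deriv g₁) x := by
    intro x hx hxz
    have hx0 : 0 ≤ x := hubar0.le.trans hx
    have h1 := half_mul_gamNum_cross_of_Lop_eq_zero (hg₁L x hx0) (hg₂L x hx0) k K
    have h2 := mul_pos (neg_pos.2 (hzd x hx0 hxz)) (mul_pos hk (hW x hx0))
    rw [← h1] at h2
    have h3 := hA3 x hx0
    exact pos_of_mul_pos_right h2 (by positivity)
  have hg₁z_pos : 0 < deriv (deriv g₁) z := hz₀b z (hx₁a.trans hza) hzb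
  set B : ℝ → ℝ := fun x => gamNum k K g₂ x / gamNum k K g₁ x with hBdef
  have hBeq : ∀ x ∈ Icc ubar z, ∀ β, B x = β ↔ gamNum k K g₂ x - β * gamNum k K g₁ x = 0 := by
    intro x hx β
    rw [hBdef, sub_eq_zero]
    exact div_eq_iff (hN₁ x hx).ne'
  have hBgam : ∀ x ∈ Icc ubar z, ∀ β, gam k K g₁ g₂ β x = 0 ↔ B x = β := fun x hx β =>
    ⟨fun h => (hBeq x hx β).2 (gamNum_sub_mul_eq_zero (hkx x hx.1) h),
      fun h => gam_eq_zero_of_gamNum hk (hW x (hubar0.le.trans hx.1)) ((hBeq x hx β).1 h)⟩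
  have hBubar : B ubar = 1 := (hBgam ubar (left_mem_Icc.2 huz.le) 1).1 hubarg
  have hBz : B z = hfun g₁ g₂ z := by
    have hz0 : 0 ≤ z := hubar0.le.trans huz.le
    have h1 := half_mul_gamNum_cross_of_Lop_eq_zero (hg₁L z hz0) (hg₂L z hz0) k K
    rw [hzc, neg_zero, zero_mul] at h1
    have h3 := hA3 z hz0
    have h2 := (mul_eq_zero.1 h1).resolve_left (by positivity)
    rw [hBdef, hfun, div_eq_div_iff (hN₁ z (right_mem_Icc.2 huz.le)).ne' hg₁z_pos.ne']
    linarith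
  set B' : ℝ → ℝ := fun x => (-(k * x - K) * deriv (deriv g₂) x * gamNum k K g₁ x -
    gamNum k K g₂ x * (-(k * x - K) * deriv (deriv g₁) x)) / gamNum k K g₁ x ^ 2
  have hBderiv : ∀ x ∈ Icc ubar z, HasDerivAt B (B' x) x := fun x hx =>
    (hasDerivAt_gamNum hg₂C k K x).div (hasDerivAt_gamNum hg₁C k K x) (hN₁ x hx).ne'
  have hdd : ∀ g : ℝ → ℝ, ContDiff ℝ 2 g → Continuous (deriv (deriv g)) := fun g hg =>
    (hg.deriv' (n := 1)).continuous_deriv le_rfl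
  have hNc : ∀ g : ℝ → ℝ, ContDiff ℝ 2 g → Continuous (gamNum k K g) := fun g hg =>
    continuous_iff_continuousAt.2 fun x => (hasDerivAt_gamNum hg k K x).continuousAt
  have hB'c : ContinuousOn B' (Ioo ubar z) := by
    have c1 := hdd g₁ hg₁C
    have c2 := hdd g₂ hg₂C
    have c3 := hNc g₁ hg₁C
    have c4 := hNc g₂ hg₂C
    refine ContinuousOn.div (by fun_prop) (by fun_prop) fun x hx => ?_
    exact pow_ne_zero 2 (hN₁ x (Ioo_subset_Icc_self hx)).ne'
  have hB'neg : ∀ x ∈ Ioo ubar z, B' x < 0 := by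
    intro x hx
    refine div_neg_of_neg_of_pos ?_ (pow_pos (hN₁ x (Ioo_subset_Icc_self hx)) 2)
    have := mul_pos (sub_pos.2 (hkx x hx.1.le)) (hcross x hx.1.le hx.2)
    linarith
  obtain ⟨hBanti, u, huc, hud, huanti, humaps, hright⟩ :=
    exists_contDiffOn_inverse_of_deriv_neg huz.le hBderiv hB'c hB'neg
  have hlt : B z < B ubar :=
    hBanti (left_mem_Icc.2 huz.le) (right_mem_Icc.2 huz.le) huz
  have hub : u (B ubar) = ubar := hBanti.injOn (humaps (right_mem_Icc.2 hlt.le))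
    (left_mem_Icc.2 huz.le) (hright _ (right_mem_Icc.2 hlt.le))
  have huzz : u (B z) = z := hBanti.injOn (humaps (left_mem_Icc.2 hlt.le))
    (right_mem_Icc.2 huz.le) (hright _ (left_mem_Icc.2 hlt.le))
  rw [hBubar] at hub hlt
  rw [hBubar, hBz] at huc hud huanti humaps hright
  rw [hBz] at huzz hlt
  refine ⟨u, ⟨huc, hud, huanti, humaps, fun β hβ => (hBgam _ (humaps hβ) β).2 (hright β hβ), ?_,
    huzz, hub⟩, fun v _ _ _ hvmaps hv β hβ => hBanti.injOn (hvmaps β hβ) (humaps hβ) ?_⟩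
  · intro β hβ
    have hβ' := Ioo_subset_Icc_self hβ
    have hlow : ubar < u β := by
      have := huanti hβ' (right_mem_Icc.2 hlt.le) hβ.2
      rwa [hub] at this
    have hupp : u β < z := by
      have := huanti (left_mem_Icc.2 hlt.le) hβ' hβ.1
      rwa [huzz] at this
    refine ⟨hlow, ?_⟩
    obtain ⟨hi1, hi2, hi3, hi4⟩ := hhinv β hβ.1.le hβ.2.le
    by_contra! hle
    have hpos : ∀ y ∈ Icc (u β) z, 0 < deriv (deriv g₁) y := fun y hy =>
      hz₀b y (hx₁a.trans_le (hi1.trans (hle.trans hy.1))) (hy.2.trans_lt hzb)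
    have hgt : β < hfun g₁ g₂ (u β) := by
      rw [hfun, lt_div_iff₀ (hpos _ (left_mem_Icc.2 hupp.le))]
      have h1 := hcross (u β) hlow.le hupp
      have h2 := (hBeq _ (humaps hβ') β).1 (hright β hβ')
      have h3 : 0 < gamNum k K g₁ (u β) *
          (deriv (deriv g₂) (u β) - β * deriv (deriv g₁) (u β)) := by
        linear_combination h1 - deriv (deriv g₁) (u β) * h2
      linarith [pos_of_mul_pos_right h3 (hN₁ _ (humaps hβ')).le]
    have hcont : ContinuousOn (hfun g₁ g₂) (Icc (u β) z) :=
      (hdd g₂ hg₂C).continuousOn.div (hdd g₁ hg₁C).continuousOn fun y hy => (hpos y hy).ne'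
    obtain ⟨y, hy, hyβ⟩ := intermediate_value_Icc' hupp.le hcont ⟨hβ.1.le, hgt.le⟩
    have hyi := hi4 y (hi1.trans (hle.trans hy.1)) hy.2 hyβ
    have huy : u β = y := le_antisymm hy.1 (hyi ▸ hle)
    rw [huy, hyβ] at hgt
    exact lt_irrefl _ hgt
  · rw [hright β hβ, (hBgam _ (hvmaps β hβ) β).1 (hv β hβ)]
end

section
/- For every β ∈ (h(z̲),1), the map β ↦ g′(u₁(β);β) is differentiable with (d/dβ)[g′(u₁(β);β)] = −g₁(u₁(β))·g′(u₁(β);β)/g(u₁(β);β). -/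
open Set Filter Topology

theorem gb_pos_of_le_one {g₁ g₂ : ℝ → ℝ} {β x : ℝ} (hβ : β ≤ 1) (hg₁x : 0 ≤ g₁ x)
    (h : g₁ x < g₂ x) : 0 < gb g₁ g₂ β x := by
  unfold gb
  nlinarith

theorem gam_eq_zero_iff_of_gb'_ne_zero {k K : ℝ} {g₁ g₂ : ℝ → ℝ} {β x : ℝ}
    (hD : gb' g₁ g₂ β x ≠ 0) :
    gam k K g₁ g₂ β x = 0 ↔ k * gb g₁ g₂ β x - (k * x - K) * gb' g₁ g₂ β x = 0 := by
  unfold gam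
  field_simp
  constructor <;> intro h <;> linear_combination h

theorem hasDerivAt_gb_comp {g₁ g₂ u : ℝ → ℝ} {β u' : ℝ}
    (hg₁ : Differentiable ℝ g₁) (hg₂ : Differentiable ℝ g₂) (hu : HasDerivAt u u' β) :
    HasDerivAt (fun b => gb g₁ g₂ b (u b)) (gb' g₁ g₂ β (u β) * u' - g₁ (u β)) β := by
  have h₁ := (hg₁ (u β)).hasDerivAt.comp β hu
  have h₂ := (hg₂ (u β)).hasDerivAt.comp β hu
  refine (h₂.sub ((hasDerivAt_id β).mul h₁)).congr_deriv ?_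
  simp only [gb', id, Function.comp_apply]
  ring

theorem hasDerivAt_gb'_comp_of_curve {k K : ℝ} {g₁ g₂ u : ℝ → ℝ} {β u' : ℝ} (hk : k ≠ 0)
    (hg₁ : ContDiff ℝ 2 g₁) (hg₂ : ContDiff ℝ 2 g₂) (hu : HasDerivAt u u' β)
    (hN : gb g₁ g₂ β (u β) ≠ 0)
    (hF : ∀ᶠ b in 𝓝 β, k * gb g₁ g₂ b (u b) - (k * u b - K) * gb' g₁ g₂ b (u b) = 0) :
    HasDerivAt (fun b => gb' g₁ g₂ b (u b))
      (-(g₁ (u β) * gb' g₁ g₂ β (u β)) / gb g₁ g₂ β (u β)) β := by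
  have hD : HasDerivAt (fun b => gb' g₁ g₂ b (u b)) _ β :=
    hasDerivAt_gb_comp hg₁.differentiable_deriv_two hg₂.differentiable_deriv_two hu
  refine hD.congr_deriv ?_
  have hN' := hasDerivAt_gb_comp (hg₁.differentiable two_ne_zero)
    (hg₂.differentiable two_ne_zero) hu
  have hF' := (hN'.const_mul k).sub (((hu.const_mul k).sub_const K).mul hD)
  have h₀ := hF'.unique ((hasDerivAt_const β (0 : ℝ)).congr_of_eventuallyEq hF)
  have hβ := hF.self_of_nhds
  set d := gb' (deriv g₁) (deriv g₂) β (u β) * u' - deriv g₁ (u β)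
  rw [eq_div_iff hN]
  apply mul_left_cancel₀ hk
  linear_combination d * hβ - gb' g₁ g₂ β (u β) * h₀

theorem stmt_12    (lam k K C xlam : ℝ) (mu sig : ℝ → ℝ)
    (hlam : 0 < lam) (hk : 0 < k) (hK : 0 < K) (hC : 0 < C)
    (hA1 : ∀ x : ℝ, 0 ≤ x → |mu x| + |sig x| ≤ C * (1 + x))
    (hA2mu : ContDiff ℝ 1 mu) (hA2sig : ContDiff ℝ 1 sig)
    (hA2muL : ∃ M : NNReal, LipschitzWith M mu)
    (hA2sigL : ∃ M : NNReal, LipschitzWith M sig)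
    (hA2muL' : ∃ M : NNReal, LipschitzWith M (deriv mu))
    (hA2sigL' : ∃ M : NNReal, LipschitzWith M (deriv sig))
    (hA3 : ∀ x : ℝ, 0 ≤ x → 0 < (sig x)^2)
    (hxlam : 0 ≤ xlam)
    (hA4a : ∀ x : ℝ, 0 ≤ x → x < xlam → lam < deriv mu x)
    (hA4b : ∀ x : ℝ, xlam ≤ x → deriv mu x ≤ lam)
    (g₁ g₂ : ℝ → ℝ)
    (hg₁C : ContDiff ℝ 2 g₁) (hg₂C : ContDiff ℝ 2 g₂)
    (hg₁pos : ∀ x : ℝ, 0 ≤ x → 0 < g₁ x) (hg₂pos : ∀ x : ℝ, 0 ≤ x → 0 < g₂ x)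
    (hg₁L : ∀ x : ℝ, 0 ≤ x → Lop mu sig lam g₁ x = 0)
    (hg₂L : ∀ x : ℝ, 0 ≤ x → Lop mu sig lam g₂ x = 0)
    (hg₁z : g₁ 0 = 1) (hg₂z : g₂ 0 = 1)
    (hg₁d : ∀ x : ℝ, 0 ≤ x → x < xlam → deriv g₁ x < 0)
    (hg₁dx : deriv g₁ xlam = 0)
    (hg₁di : ∀ x : ℝ, xlam < x → 0 < deriv g₁ x)
    (hg₁dd : ∀ x : ℝ, xlam ≤ x → 0 < deriv (deriv g₁) x)
    (hg₂mono : StrictMonoOn g₂ (Ici (0:ℝ)))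
    (hg₂d0 : 0 < deriv g₂ 0)
    (z₀ : ℝ) (hz₀ge : 0 ≤ z₀) (hz₀lt : z₀ < xlam)
    (hz₀eq : 0 ≤ deriv (deriv g₁) 0 → z₀ = 0)
    (hz₀a : ∀ x : ℝ, 0 < x → x < z₀ → deriv (deriv g₁) x < 0)
    (hz₀b : ∀ x : ℝ, z₀ < x → x < xlam → 0 < deriv (deriv g₁) x)
    (hW : ∀ x : ℝ, 0 ≤ x → 0 < Wron g₁ g₂ x)
    (hgd : ∀ x : ℝ, 0 ≤ x → 0 < gb' g₁ g₂ 1 x)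
    (x₁ : ℝ) (hx₁a : z₀ < x₁) (hx₁b : x₁ ≤ xlam)
    (hx₁c : ∀ x : ℝ, 0 ≤ x → x < x₁ → 0 < gb'' g₁ g₂ 1 x)
    (hx₁d : gb'' g₁ g₂ 1 x₁ = 0)
    (hmux : 0 < mu xlam * k - lam * (k * xlam - K))
    (z : ℝ) (hza : x₁ < z) (hzb : z < xlam)
    (hzc : mu z * k - lam * (k * z - K) = 0)
    (hzd : ∀ x : ℝ, 0 ≤ x → x < z → mu x * k - lam * (k * x - K) < 0)
    (ubar : ℝ) (hubar0 : 0 < ubar) (hubar1 : ubar < x₁)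
    (hubarg : gam k K g₁ g₂ 1 ubar = 0)
    (hinv : ℝ → ℝ)
    (hhinv : ∀ β : ℝ, hfun g₁ g₂ z ≤ β → β ≤ 1 →
      x₁ ≤ hinv β ∧ hinv β ≤ z ∧ hfun g₁ g₂ (hinv β) = β ∧
      (∀ y : ℝ, x₁ ≤ y → y ≤ z → hfun g₁ g₂ y = β → y = hinv β))
    (u₁ : ℝ → ℝ)
    (hu₁cont : ContinuousOn u₁ (Icc (hfun g₁ g₂ z) 1))
    (hu₁cd : ContDiffOn ℝ 1 u₁ (Ioo (hfun g₁ g₂ z) 1))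
    (hu₁anti : StrictAntiOn u₁ (Icc (hfun g₁ g₂ z) 1))
    (hu₁mem : ∀ β ∈ Icc (hfun g₁ g₂ z) 1, u₁ β ∈ Icc ubar z)
    (hu₁gam : ∀ β ∈ Icc (hfun g₁ g₂ z) 1, gam k K g₁ g₂ β (u₁ β) = 0)
    (hu₁l : u₁ (hfun g₁ g₂ z) = z) (hu₁r : u₁ 1 = ubar)
    :
    ∀ β ∈ Ioo (hfun g₁ g₂ z) 1,
      HasDerivAt (fun b' => gb' g₁ g₂ b' (u₁ b'))
        (-(g₁ (u₁ β) * gb' g₁ g₂ β (u₁ β)) / gb g₁ g₂ β (u₁ β)) β := by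
  have hIcc := Ioo_subset_Icc_self (a := hfun g₁ g₂ z) (b := 1)
  have hN : ∀ b ∈ Ioo (hfun g₁ g₂ z) 1, 0 < gb g₁ g₂ b (u₁ b) := by
    intro b hb
    obtain ⟨hul, hur⟩ := hu₁mem b (hIcc hb)
    have hu0 : 0 < u₁ b := hubar0.trans_le hul
    have hg₁anti : AntitoneOn g₁ (Icc 0 xlam) := by
      refine antitoneOn_of_deriv_nonpos (convex_Icc 0 xlam) hg₁C.continuous.continuousOn
        (hg₁C.differentiable two_ne_zero).differentiableOn fun x hx => ?_
      rw [interior_Icc] at hx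
      exact (hg₁d x hx.1.le hx.2).le
    have h₁ := hg₁anti ⟨le_rfl, hxlam⟩ ⟨hu0.le, hur.trans hzb.le⟩ hu0.le
    have h₂ := hg₂mono self_mem_Ici hu0.le hu0
    exact gb_pos_of_le_one hb.2.le (hg₁pos _ hu0.le).le (by linarith)
  have hu : ∀ b ∈ Ioo (hfun g₁ g₂ z) 1, HasDerivAt u₁ (deriv u₁ b) b := fun b hb =>
    ((hu₁cd.differentiableOn one_ne_zero).differentiableAt (isOpen_Ioo.mem_nhds hb)).hasDerivAt
  have hF : ∀ b ∈ Ioo (hfun g₁ g₂ z) 1,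
      k * gb g₁ g₂ b (u₁ b) - (k * u₁ b - K) * gb' g₁ g₂ b (u₁ b) = 0 := by
    intro b hb
    by_cases hD : gb' g₁ g₂ b (u₁ b) = 0
    · have hub : k * u₁ b = K := by
        have h := hu₁gam b (hIcc hb)
        rw [gam, hD, div_zero] at h
        linarith
      have hcont : ContinuousAt
          (fun c => k * gb g₁ g₂ c (u₁ c) - (k * u₁ c - K) * gb' g₁ g₂ c (u₁ c)) b := by
        have hN' := (hasDerivAt_gb_comp (hg₁C.differentiable two_ne_zero)
          (hg₂C.differentiable two_ne_zero) (hu b hb)).continuousAt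
        have hD' : ContinuousAt (fun c => gb' g₁ g₂ c (u₁ c)) b :=
          (hasDerivAt_gb_comp hg₁C.differentiable_deriv_two hg₂C.differentiable_deriv_two
            (hu b hb)).continuousAt
        have hu' := (hu b hb).continuousAt
        fun_prop
      -- `u₁` is injective, so the degenerate value `K / k` is taken only at `b`.
      refine tendsto_nhds_unique (hcont.tendsto.mono_left (nhdsWithin_le_nhds (s := {b}ᶜ)))
        (tendsto_const_nhds.congr' ?_)
      filter_upwards [self_mem_nhdsWithin, nhdsWithin_le_nhds (isOpen_Ioo.mem_nhds hb)]
        with c hcb hc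
      refine ((gam_eq_zero_iff_of_gb'_ne_zero fun hDc => hcb ?_).1 (hu₁gam c (hIcc hc))).symm
      have h := hu₁gam c (hIcc hc)
      rw [gam, hDc, div_zero] at h
      exact hu₁anti.injOn (hIcc hc) (hIcc hb) (mul_left_cancel₀ hk.ne' (by linarith))
    · exact (gam_eq_zero_iff_of_gb'_ne_zero hD).1 (hu₁gam b (hIcc hb))
  intro β hβ
  exact hasDerivAt_gb'_comp_of_curve hk.ne' hg₁C hg₂C (hu β hβ) (hN β hβ).ne'
    (eventually_of_mem (isOpen_Ioo.mem_nhds hβ) hF)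
end

section
/- Assume further g″(x) ≤ 0 for all x > x_λ (case R7) and that the limits a = lim_{x→∞} g₁′(x) and b = lim_{x→∞} g₂′(x) exist and are finite, and define G(β) = (b − βa)/g′(u₁(β);β) for β ∈ [h(z̲),1]. Then G is continuously differentiable and strictly increasing on (h(z̲),1). -/
open Set Filter Topology

/-- Along a curve `u` of zeros of `gam` on which `gb'` does not vanish, the derivative of
`β ↦ gb' β (u β)` satisfies a first order linear equation. -/
theorem mul_deriv_gb'_comp {g₁ g₂ u : ℝ → ℝ} {k K β u' D' : ℝ}
    (hg₁ : DifferentiableAt ℝ g₁ (u β)) (hg₂ : DifferentiableAt ℝ g₂ (u β))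
    (hu : HasDerivAt u u' β)
    (hD : HasDerivAt (fun t => gb' g₁ g₂ t (u t)) D' β)
    (hz : ∀ᶠ t in 𝓝 β, k * gb g₁ g₂ t (u t) = (k * u t - K) * gb' g₁ g₂ t (u t)) :
    (k * u β - K) * D' = -(k * g₁ (u β)) := by
  have h₁ : HasDerivAt (fun t => g₁ (u t)) (deriv g₁ (u β) * u') β :=
    hg₁.hasDerivAt.comp β hu
  have h₂ : HasDerivAt (fun t => g₂ (u t)) (deriv g₂ (u β) * u') β :=
    hg₂.hasDerivAt.comp β hu
  have hL := (h₂.sub ((hasDerivAt_id β).mul h₁)).const_mul k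
  have hR := ((hu.const_mul k).sub_const K).mul hD
  have hz' : (fun t => k * (g₂ (u t) - id t * g₁ (u t))) =ᶠ[𝓝 β]
      fun t => (k * u t - K) * gb' g₁ g₂ t (u t) := hz
  have := hL.unique (hR.congr_of_eventuallyEq hz')
  simp only [gb', id] at this
  linear_combination -this

/-- If the Wronskian of two positive functions is positive on `[0, ∞)`, their quotient is strictly
increasing there. -/
theorem strictMonoOn_div_of_Wron_pos {g₁ g₂ : ℝ → ℝ}
    (hg₁ : Differentiable ℝ g₁) (hg₂ : Differentiable ℝ g₂)
    (hpos : ∀ x, 0 ≤ x → 0 < g₁ x) (hW : ∀ x, 0 ≤ x → 0 < Wron g₁ g₂ x) :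
    StrictMonoOn (fun x => g₂ x / g₁ x) (Ici 0) := by
  refine strictMonoOn_of_deriv_pos (convex_Ici 0)
    (hg₂.continuous.continuousOn.div hg₁.continuous.continuousOn fun x hx => (hpos x hx).ne') ?_
  intro x hx
  rw [interior_Ici, mem_Ioi] at hx
  have hp := hpos x hx.le
  have hw := hW x hx.le
  have h := (hg₂ x).hasDerivAt.fun_div (hg₁ x).hasDerivAt hp.ne'
  rw [h.deriv]
  unfold Wron at hw
  exact div_pos (by linarith) (by positivity)

/-- If the Wronskian is positive and `g₁` is eventually increasing, the limits of the derivatives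
dominate the quotient `g₂ / g₁`. -/
theorem limit_deriv_cross_lt_of_Wron_pos {g₁ g₂ : ℝ → ℝ} {a b c x : ℝ}
    (hg₁ : Differentiable ℝ g₁) (hg₂ : Differentiable ℝ g₂)
    (hpos : ∀ x, 0 ≤ x → 0 < g₁ x) (hW : ∀ x, 0 ≤ x → 0 < Wron g₁ g₂ x)
    (hmono : ∀ y, c < y → 0 < deriv g₁ y)
    (ha : Tendsto (deriv g₁) atTop (𝓝 a)) (hb : Tendsto (deriv g₂) atTop (𝓝 b))
    (ha0 : 0 < a) (hx : 0 ≤ x) (hxc : x < c) :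
    a * g₂ x < b * g₁ x := by
  have hq := strictMonoOn_div_of_Wron_pos hg₁ hg₂ hpos hW
  have hc : 0 ≤ c := hx.trans hxc.le
  have hle : a * (g₂ c / g₁ c) ≤ b := by
    refine le_of_tendsto_of_tendsto (ha.mul_const _) hb ?_
    filter_upwards [eventually_gt_atTop c] with y hy
    have hy0 : 0 ≤ y := hc.trans hy.le
    have hp := hpos y hy0
    have hw := hW y hy0
    unfold Wron at hw
    have hlt : g₂ c / g₁ c < g₂ y / g₁ y := hq hc hy0 hy
    have h := mul_lt_mul_of_pos_left hlt (hmono y hy)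
    have h' : deriv g₁ y * (g₂ y / g₁ y) < deriv g₂ y := by
      rw [← mul_div_assoc, div_lt_iff₀ hp]
      linarith
    exact (h.trans h').le
  have hlt : g₂ x / g₁ x < g₂ c / g₁ c := hq hx hc hxc
  have h := (mul_lt_mul_of_pos_left hlt ha0).trans_le hle
  rwa [← mul_div_assoc, div_lt_iff₀ (hpos x hx)] at h

theorem stmt_13    (lam k K C xlam : ℝ) (mu sig : ℝ → ℝ)
    (hlam : 0 < lam) (hk : 0 < k) (hK : 0 < K) (hC : 0 < C)
    (hA1 : ∀ x : ℝ, 0 ≤ x → |mu x| + |sig x| ≤ C * (1 + x))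
    (hA2mu : ContDiff ℝ 1 mu) (hA2sig : ContDiff ℝ 1 sig)
    (hA2muL : ∃ M : NNReal, LipschitzWith M mu)
    (hA2sigL : ∃ M : NNReal, LipschitzWith M sig)
    (hA2muL' : ∃ M : NNReal, LipschitzWith M (deriv mu))
    (hA2sigL' : ∃ M : NNReal, LipschitzWith M (deriv sig))
    (hA3 : ∀ x : ℝ, 0 ≤ x → 0 < (sig x)^2)
    (hxlam : 0 ≤ xlam)
    (hA4a : ∀ x : ℝ, 0 ≤ x → x < xlam → lam < deriv mu x)
    (hA4b : ∀ x : ℝ, xlam ≤ x → deriv mu x ≤ lam)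
    (g₁ g₂ : ℝ → ℝ)
    (hg₁C : ContDiff ℝ 2 g₁) (hg₂C : ContDiff ℝ 2 g₂)
    (hg₁pos : ∀ x : ℝ, 0 ≤ x → 0 < g₁ x) (hg₂pos : ∀ x : ℝ, 0 ≤ x → 0 < g₂ x)
    (hg₁L : ∀ x : ℝ, 0 ≤ x → Lop mu sig lam g₁ x = 0)
    (hg₂L : ∀ x : ℝ, 0 ≤ x → Lop mu sig lam g₂ x = 0)
    (hg₁z : g₁ 0 = 1) (hg₂z : g₂ 0 = 1)
    (hg₁d : ∀ x : ℝ, 0 ≤ x → x < xlam → deriv g₁ x < 0)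
    (hg₁dx : deriv g₁ xlam = 0)
    (hg₁di : ∀ x : ℝ, xlam < x → 0 < deriv g₁ x)
    (hg₁dd : ∀ x : ℝ, xlam ≤ x → 0 < deriv (deriv g₁) x)
    (hg₂mono : StrictMonoOn g₂ (Ici (0:ℝ)))
    (hg₂d0 : 0 < deriv g₂ 0)
    (z₀ : ℝ) (hz₀ge : 0 ≤ z₀) (hz₀lt : z₀ < xlam)
    (hz₀eq : 0 ≤ deriv (deriv g₁) 0 → z₀ = 0)
    (hz₀a : ∀ x : ℝ, 0 < x → x < z₀ → deriv (deriv g₁) x < 0)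
    (hz₀b : ∀ x : ℝ, z₀ < x → x < xlam → 0 < deriv (deriv g₁) x)
    (hW : ∀ x : ℝ, 0 ≤ x → 0 < Wron g₁ g₂ x)
    (hgd : ∀ x : ℝ, 0 ≤ x → 0 < gb' g₁ g₂ 1 x)
    (x₁ : ℝ) (hx₁a : z₀ < x₁) (hx₁b : x₁ ≤ xlam)
    (hx₁c : ∀ x : ℝ, 0 ≤ x → x < x₁ → 0 < gb'' g₁ g₂ 1 x)
    (hx₁d : gb'' g₁ g₂ 1 x₁ = 0)
    (hmux : 0 < mu xlam * k - lam * (k * xlam - K))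
    (z : ℝ) (hza : x₁ < z) (hzb : z < xlam)
    (hzc : mu z * k - lam * (k * z - K) = 0)
    (hzd : ∀ x : ℝ, 0 ≤ x → x < z → mu x * k - lam * (k * x - K) < 0)
    (ubar : ℝ) (hubar0 : 0 < ubar) (hubar1 : ubar < x₁)
    (hubarg : gam k K g₁ g₂ 1 ubar = 0)
    (hinv : ℝ → ℝ)
    (hhinv : ∀ β : ℝ, hfun g₁ g₂ z ≤ β → β ≤ 1 →
      x₁ ≤ hinv β ∧ hinv β ≤ z ∧ hfun g₁ g₂ (hinv β) = β ∧
      (∀ y : ℝ, x₁ ≤ y → y ≤ z → hfun g₁ g₂ y = β → y = hinv β))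
    (u₁ : ℝ → ℝ)
    (hu₁cont : ContinuousOn u₁ (Icc (hfun g₁ g₂ z) 1))
    (hu₁cd : ContDiffOn ℝ 1 u₁ (Ioo (hfun g₁ g₂ z) 1))
    (hu₁anti : StrictAntiOn u₁ (Icc (hfun g₁ g₂ z) 1))
    (hu₁mem : ∀ β ∈ Icc (hfun g₁ g₂ z) 1, u₁ β ∈ Icc ubar z)
    (hu₁gam : ∀ β ∈ Icc (hfun g₁ g₂ z) 1, gam k K g₁ g₂ β (u₁ β) = 0)
    (hu₁l : u₁ (hfun g₁ g₂ z) = z) (hu₁r : u₁ 1 = ubar)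
    (hR7 : ∀ x : ℝ, xlam < x → gb'' g₁ g₂ 1 x ≤ 0)
    (a b : ℝ)
    (hga : Tendsto (deriv g₁) atTop (𝓝 a))
    (hgb : Tendsto (deriv g₂) atTop (𝓝 b)) :
    ContDiffOn ℝ 1 (fun β => (b - β * a) / gb' g₁ g₂ β (u₁ β))
      (Ioo (hfun g₁ g₂ z) 1) ∧
    StrictMonoOn (fun β => (b - β * a) / gb' g₁ g₂ β (u₁ β))
      (Ioo (hfun g₁ g₂ z) 1) := by
  have hd₁ : Differentiable ℝ g₁ := hg₁C.differentiable (by norm_num)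
  have hd₂ : Differentiable ℝ g₂ := hg₂C.differentiable (by norm_num)
  have hC₁ : ContDiff ℝ 1 (deriv g₁) := hg₁C.deriv'
  have hC₂ : ContDiff ℝ 1 (deriv g₂) := hg₂C.deriv'
  have ha0 : 0 < a := by
    have hm : StrictMonoOn (deriv g₁) (Ici xlam) := by
      refine strictMonoOn_of_deriv_pos (convex_Ici _) hC₁.continuous.continuousOn ?_
      intro x hx
      rw [interior_Ici, mem_Ioi] at hx
      exact hg₁dd x hx.le
    refine (hg₁di (xlam + 1) (by linarith)).trans_le (ge_of_tendsto hga ?_)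
    filter_upwards [eventually_ge_atTop (xlam + 1)] with x hx
    exact hm.monotoneOn (by simp) (by simp only [mem_Ici]; linarith) hx
  have hg1pos : ∀ x, 0 < x → 0 < gb g₁ g₂ 1 x := by
    have hm : StrictMonoOn (gb g₁ g₂ 1) (Ici 0) := by
      have hder : ∀ x, HasDerivAt (gb g₁ g₂ 1) (gb' g₁ g₂ 1 x) x := fun x =>
        (hd₂ x).hasDerivAt.sub ((hd₁ x).hasDerivAt.const_mul 1)
      refine strictMonoOn_of_deriv_pos (convex_Ici _)
        (fun x _ => (hder x).continuousAt.continuousWithinAt) ?_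
      intro x hx
      rw [interior_Ici, mem_Ioi] at hx
      rw [(hder x).deriv]
      exact hgd x hx.le
    intro x hx
    have h := hm self_mem_Ici hx.le hx
    simpa [gb, hg₁z, hg₂z] using h
  have hv1 : 0 < k * ubar - K := by
    have h := div_pos (hg1pos ubar hubar0) (hgd ubar hubar0.le)
    have h' := mul_pos hk h
    unfold gam at hubarg
    linarith
  set I := Ioo (hfun g₁ g₂ z) 1
  have hsub : ∀ β ∈ I, β ∈ Icc (hfun g₁ g₂ z) 1 := fun β hβ => Ioo_subset_Icc_self hβ
  have hupos : ∀ β ∈ I, 0 < u₁ β := fun β hβ => hubar0.trans_le (hu₁mem β (hsub β hβ)).1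
  have hulam : ∀ β ∈ I, u₁ β < xlam := fun β hβ => (hu₁mem β (hsub β hβ)).2.trans_lt hzb
  have hv : ∀ β ∈ I, 0 < k * u₁ β - K := fun β hβ => by
    have := mul_le_mul_of_nonneg_left (hu₁mem β (hsub β hβ)).1 hk.le
    linarith
  have hgpos : ∀ β ∈ I, 0 < gb g₁ g₂ β (u₁ β) := fun β hβ => by
    have h₁ := hg1pos _ (hupos β hβ)
    have h₂ := mul_pos (sub_pos.2 hβ.2) (hg₁pos _ (hupos β hβ).le)
    unfold gb at h₁ ⊢
    linarith
  have hDne : ∀ β ∈ I, gb' g₁ g₂ β (u₁ β) ≠ 0 := fun β hβ h0 => by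
    have h := hu₁gam β (hsub β hβ)
    rw [gam, h0, div_zero] at h
    linarith [hv β hβ]
  have hzero : ∀ β ∈ I,
      k * gb g₁ g₂ β (u₁ β) = (k * u₁ β - K) * gb' g₁ g₂ β (u₁ β) := fun β hβ => by
    have h := hu₁gam β (hsub β hβ)
    have h0 := hDne β hβ
    unfold gam at h
    field_simp at h
    linear_combination h
  have hDpos : ∀ β ∈ I, 0 < gb' g₁ g₂ β (u₁ β) := fun β hβ =>
    pos_of_mul_pos_right (hzero β hβ ▸ mul_pos hk (hgpos β hβ)) (hv β hβ).le
  have hDC : ContDiffOn ℝ 1 (fun β => gb' g₁ g₂ β (u₁ β)) I :=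
    (hC₂.comp_contDiffOn hu₁cd).sub (contDiffOn_id.mul (hC₁.comp_contDiffOn hu₁cd))
  have hNC : ContDiffOn ℝ 1 (fun β => b - β * a) I := by fun_prop
  have hGC := hNC.div hDC hDne
  refine ⟨hGC, strictMonoOn_of_deriv_pos (convex_Ioo _ _) hGC.continuousOn ?_⟩
  intro β hβ
  rw [interior_Ioo] at hβ
  have hnhds : I ∈ 𝓝 β := Ioo_mem_nhds hβ.1 hβ.2
  have hu' := ((hu₁cd.differentiableOn (by norm_num)).differentiableAt hnhds).hasDerivAt
  have hD' := ((hDC.differentiableOn (by norm_num)).differentiableAt hnhds).hasDerivAt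
  have hode := mul_deriv_gb'_comp (hd₁ _) (hd₂ _) hu' hD'
    (mem_of_superset hnhds hzero)
  set D' := deriv (fun t => gb' g₁ g₂ t (u₁ t)) β
  have hN' : HasDerivAt (fun t => b - t * a) (-(1 * a)) β :=
    ((hasDerivAt_id β).mul_const a).const_sub b
  rw [(hN'.fun_div hD' (hDne β hβ)).deriv]
  refine div_pos ?_ (pow_pos (hDpos β hβ) 2)
  have hcross := limit_deriv_cross_lt_of_Wron_pos hd₁ hd₂ hg₁pos hW hg₁di hga hgb ha0
    (hupos β hβ).le (hulam β hβ)
  have hvN : (k * u₁ β - K) * (-(1 * a) * gb' g₁ g₂ β (u₁ β) - (b - β * a) * D') =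
      k * (b * g₁ (u₁ β) - a * g₂ (u₁ β)) := by
    have hz' := hzero β hβ
    simp only [gb] at hz'
    linear_combination a * hz' - (b - β * a) * hode
  exact pos_of_mul_pos_right (hvN ▸ mul_pos hk (sub_pos.2 hcross)) (hv β hβ).le
end

section
/- Assume W(x) > 0 and g₁(x) > 0 for all x ≥ 0. Let I ⊆ (0,1) be an open interval and u, w : I → (0,∞) differentiable functions such that for every β ∈ I: u(β) < w(β), γ(β,u(β)) = 0, g′(w(β);β) = g′(u(β);β) > 0, and g(u(β);β) > 0. Define J(β) = k·( w(β) − u(β) − (g(w(β);β) − g(u(β);β))/g′(w(β);β) ). Then J is strictly decreasing on I. (This gives that, in the setting of Lemma 2.6 of the paper, both J₁(β) = J(β,u₁(β),u₂(β)) and J₁₃(β) = J(β,u₁(β),u₃(β)) are strictly decreasing.) -/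
open Set Filter Topology

theorem strictMonoOn_div_of_wron_pos {g₁ g₂ : ℝ → ℝ} (h₁ : Differentiable ℝ g₁)
    (h₂ : Differentiable ℝ g₂) (hpos : ∀ x : ℝ, 0 ≤ x → 0 < g₁ x)
    (hW : ∀ x : ℝ, 0 ≤ x → 0 < Wron g₁ g₂ x) :
    StrictMonoOn (fun x => g₂ x / g₁ x) (Ici (0:ℝ)) := by
  apply strictMonoOn_of_deriv_pos (convex_Ici 0)
  · exact h₂.continuous.continuousOn.div h₁.continuous.continuousOn
      fun x hx => (hpos x hx).ne'
  · intro x hx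
    rw [interior_Ici] at hx
    have hx' : (0:ℝ) ≤ x := le_of_lt hx
    have h := (h₂ x).hasDerivAt.fun_div (h₁ x).hasDerivAt (hpos x hx').ne'
    rw [h.deriv]
    have hw := hW x hx'
    rw [Wron] at hw
    exact div_pos (by linarith) (pow_pos (hpos x hx') 2)

theorem hasDerivAt_gb_comp_s14 {g₁ g₂ v : ℝ → ℝ} {β v' : ℝ} (h₁ : Differentiable ℝ g₁)
    (h₂ : Differentiable ℝ g₂) (hv : HasDerivAt v v' β) :
    HasDerivAt (fun t => gb g₁ g₂ t (v t)) (gb' g₁ g₂ β (v β) * v' - g₁ (v β)) β := by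
  have e₁ : HasDerivAt (fun t => g₁ (v t)) (deriv g₁ (v β) * v') β :=
    (h₁ (v β)).hasDerivAt.comp β hv
  have e₂ : HasDerivAt (fun t => g₂ (v t)) (deriv g₂ (v β) * v') β :=
    (h₂ (v β)).hasDerivAt.comp β hv
  refine (e₂.sub ((hasDerivAt_id β).mul e₁)).congr_deriv ?_
  simp only [gb', id]
  ring

theorem stmt_14    (lam k K C xlam : ℝ) (mu sig : ℝ → ℝ)
    (hlam : 0 < lam) (hk : 0 < k) (hK : 0 < K) (hC : 0 < C)
    (hA1 : ∀ x : ℝ, 0 ≤ x → |mu x| + |sig x| ≤ C * (1 + x))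
    (hA2mu : ContDiff ℝ 1 mu) (hA2sig : ContDiff ℝ 1 sig)
    (hA2muL : ∃ M : NNReal, LipschitzWith M mu)
    (hA2sigL : ∃ M : NNReal, LipschitzWith M sig)
    (hA2muL' : ∃ M : NNReal, LipschitzWith M (deriv mu))
    (hA2sigL' : ∃ M : NNReal, LipschitzWith M (deriv sig))
    (hA3 : ∀ x : ℝ, 0 ≤ x → 0 < (sig x)^2)
    (hxlam : 0 ≤ xlam)
    (hA4a : ∀ x : ℝ, 0 ≤ x → x < xlam → lam < deriv mu x)
    (hA4b : ∀ x : ℝ, xlam ≤ x → deriv mu x ≤ lam)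
    (g₁ g₂ : ℝ → ℝ)
    (hg₁C : ContDiff ℝ 2 g₁) (hg₂C : ContDiff ℝ 2 g₂)
    (hg₁pos : ∀ x : ℝ, 0 ≤ x → 0 < g₁ x) (hg₂pos : ∀ x : ℝ, 0 ≤ x → 0 < g₂ x)
    (hg₁L : ∀ x : ℝ, 0 ≤ x → Lop mu sig lam g₁ x = 0)
    (hg₂L : ∀ x : ℝ, 0 ≤ x → Lop mu sig lam g₂ x = 0)
    (hg₁z : g₁ 0 = 1) (hg₂z : g₂ 0 = 1)
    (hg₂mono : StrictMonoOn g₂ (Ici (0:ℝ)))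
    (hW : ∀ x : ℝ, 0 ≤ x → 0 < Wron g₁ g₂ x)
    (a b : ℝ) (hab : Ioo a b ⊆ Ioo (0:ℝ) 1)
    (u w : ℝ → ℝ)
    (hud : ∀ β ∈ Ioo a b, DifferentiableAt ℝ u β)
    (hwd : ∀ β ∈ Ioo a b, DifferentiableAt ℝ w β)
    (hupos : ∀ β ∈ Ioo a b, 0 < u β)
    (huw : ∀ β ∈ Ioo a b, u β < w β)
    (hugam : ∀ β ∈ Ioo a b, gam k K g₁ g₂ β (u β) = 0)
    (heq : ∀ β ∈ Ioo a b, gb' g₁ g₂ β (w β) = gb' g₁ g₂ β (u β))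
    (hdpos : ∀ β ∈ Ioo a b, 0 < gb' g₁ g₂ β (u β))
    (hgbpos : ∀ β ∈ Ioo a b, 0 < gb g₁ g₂ β (u β)) :
    StrictAntiOn
      (fun β => k * (w β - u β - (gb g₁ g₂ β (w β) - gb g₁ g₂ β (u β)) / gb' g₁ g₂ β (w β)))
      (Ioo a b) := by
  have d₁ : Differentiable ℝ g₁ := hg₁C.differentiable (by norm_num)
  have d₂ : Differentiable ℝ g₂ := hg₂C.differentiable (by norm_num)
  have dd₁ : Differentiable ℝ (deriv g₁) := hg₁C.differentiable_deriv_two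
  have dd₂ : Differentiable ℝ (deriv g₂) := hg₂C.differentiable_deriv_two
  have key : ∀ β ∈ Ioo a b, ∃ D < 0, HasDerivAt
      (fun β => k * (w β - u β - (gb g₁ g₂ β (w β) - gb g₁ g₂ β (u β)) / gb' g₁ g₂ β (w β)))
      D β := by
    intro β hβ
    have hu := (hud β hβ).hasDerivAt
    have hw := (hwd β hβ).hasDerivAt
    have hGu := hdpos β hβ
    have hG : 0 < gb' g₁ g₂ β (w β) := heq β hβ ▸ hGu
    have hgu := hgbpos β hβ
    obtain ⟨G', hG'⟩ : ∃ G', HasDerivAt (fun t => gb' g₁ g₂ t (w t)) G' β :=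
      ⟨_, ((dd₂ (w β)).hasDerivAt.comp β hw).sub
        ((hasDerivAt_id β).mul ((dd₁ (w β)).hasDerivAt.comp β hw))⟩
    have eu := hasDerivAt_gb_comp_s14 d₁ d₂ hu
    have ew := hasDerivAt_gb_comp_s14 d₁ d₂ hw
    have hconst : HasDerivAt (fun t => gb g₁ g₂ t (u t) / gb' g₁ g₂ t (w t) - u t) 0 β := by
      refine (hasDerivAt_const β (-K / k)).congr_of_eventuallyEq ?_
      filter_upwards [isOpen_Ioo.mem_nhds hβ] with t ht
      have h := hugam t ht
      rw [gam, ← heq t ht] at h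
      rw [eq_div_iff hk.ne']
      linarith
    have hz := ((eu.fun_div hG' hG.ne').fun_sub hu).unique hconst
    have hJ := ((hw.fun_sub hu).fun_sub ((ew.fun_sub eu).fun_div hG' hG.ne')).const_mul k
    refine ⟨_, ?_, hJ⟩
    have hw0 : 0 < w β := (hupos β hβ).trans (huw β hβ)
    have hmono := strictMonoOn_div_of_wron_pos d₁ d₂ hg₁pos hW (mem_Ici.2 (hupos β hβ).le)
      (mem_Ici.2 hw0.le) (huw β hβ)
    simp only at hmono
    rw [div_lt_div_iff₀ (hg₁pos _ (hupos β hβ).le) (hg₁pos _ hw0.le)] at hmono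
    have hcross : gb g₁ g₂ β (u β) * g₁ (w β) - gb g₁ g₂ β (w β) * g₁ (u β) < 0 := by
      simp only [gb]
      linarith
    rw [← heq β hβ] at hz ⊢
    generalize gb' g₁ g₂ β (w β) = G at *
    generalize gb g₁ g₂ β (u β) = p at *
    generalize gb g₁ g₂ β (w β) = q at *
    have hGval : G' = -(g₁ (u β) * G) / p := by
      field_simp at hz ⊢
      linarith
    rw [hGval]
    refine mul_neg_of_pos_of_neg hk ?_
    have := div_neg_of_neg_of_pos hcross (mul_pos hG hgu)
    convert this using 1
    field_simp
    ring
  refine strictAntiOn_of_deriv_neg (convex_Ioo a b) ?_ ?_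
  · intro β hβ
    obtain ⟨D, -, h⟩ := key β hβ
    exact h.continuousAt.continuousWithinAt
  · intro β hβ
    rw [interior_Ioo] at hβ
    obtain ⟨D, hD, h⟩ := key β hβ
    rwa [h.deriv]
end

section
/- Assume further g″(x) ≤ 0 for all x > x_λ (case R7), that the limits a = lim_{x→∞} g₁′(x) and b = lim_{x→∞} g₂′(x) exist and are finite, and that b − a > g′(ū*) (equivalently G(1) > 1), where G(β) = (b − βa)/g′(u₁(β);β) for β ∈ [h(z̲),1] and h_∞ = lim_{x→∞} h(x). Suppose either (H1) h(z̲) ≥ h_∞, or (H2) h(z̲) < h_∞ < 1 and G(h_∞) ≤ 1. Then there exists a unique β̂ ∈ (h(z̲),1) with G(β̂) = 1; moreover u₁(β̂) < z̲. -/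
open Set Filter Topology

theorem exists_lt_zero_of_tendsto_deriv {f : ℝ → ℝ} {l : ℝ} (hf : Differentiable ℝ f)
    (hlim : Tendsto (deriv f) atTop (𝓝 l)) (hl : l < 0) (y : ℝ) : ∃ x, y ≤ x ∧ f x < 0 := by
  obtain ⟨N, hN⟩ := eventually_atTop.1 (hlim.eventually (gt_mem_nhds (show l < l / 2 by linarith)))
  set M := max N y
  have hbd : ∀ x, M ≤ x → f x - f M ≤ l / 2 * (x - M) := by
    intro x hx
    refine (convex_Ici M).image_sub_le_mul_sub_of_deriv_le hf.continuous.continuousOn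
      hf.differentiableOn ?_ M self_mem_Ici x hx hx
    intro w hw
    rw [interior_Ici] at hw
    exact (hN w ((le_max_left N y).trans (le_of_lt hw))).le
  have hq : 0 ≤ (|f M| + 1) / (-l / 2) := by
    have : 0 < -l / 2 := by linarith
    positivity
  refine ⟨M + (|f M| + 1) / (-l / 2), (le_max_right N y).trans (by linarith), ?_⟩
  have h := hbd (M + (|f M| + 1) / (-l / 2)) (by linarith)
  have he : l / 2 * (M + (|f M| + 1) / (-l / 2) - M) = -(|f M| + 1) := by
    have : l ≠ 0 := hl.ne
    field_simp
    ring
  rw [he] at h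
  linarith [le_abs_self (f M)]

theorem ContDiff.hasDerivAt_two {g : ℝ → ℝ} (hg : ContDiff ℝ 2 g) (x : ℝ) :
    HasDerivAt g (deriv g x) x ∧ HasDerivAt (deriv g) (deriv (deriv g) x) x := by
  refine ⟨(hg.differentiable (by norm_num) x).hasDerivAt, ?_⟩
  have h : ContDiff ℝ 1 (deriv g) :=
    (contDiff_succ_iff_deriv.1 (show ContDiff ℝ (1 + 1) g by simpa [one_add_one_eq_two] using hg)).2.2
  exact (h.differentiable (by norm_num) x).hasDerivAt

theorem hasDerivAt_gb {g₁ g₂ : ℝ → ℝ} (hg₁ : ContDiff ℝ 2 g₁) (hg₂ : ContDiff ℝ 2 g₂)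
    (β x : ℝ) : HasDerivAt (gb g₁ g₂ β) (gb' g₁ g₂ β x) x :=
  (hg₂.hasDerivAt_two x).1.sub ((hg₁.hasDerivAt_two x).1.const_mul β)

theorem hasDerivAt_gb' {g₁ g₂ : ℝ → ℝ} (hg₁ : ContDiff ℝ 2 g₁) (hg₂ : ContDiff ℝ 2 g₂)
    (β x : ℝ) : HasDerivAt (gb' g₁ g₂ β) (gb'' g₁ g₂ β x) x :=
  (hg₂.hasDerivAt_two x).2.sub ((hg₁.hasDerivAt_two x).2.const_mul β)

theorem mul_lt_mul_of_wron_pos {g₁ g₂ : ℝ → ℝ} {a b x : ℝ}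
    (hg₁ : ContDiff ℝ 2 g₁) (hg₂ : ContDiff ℝ 2 g₂) (hpos : ∀ x, 0 ≤ x → 0 < g₁ x)
    (hW : ∀ x, 0 ≤ x → 0 < Wron g₁ g₂ x) (ha : 0 < a)
    (hga : Tendsto (deriv g₁) atTop (𝓝 a)) (hgb : Tendsto (deriv g₂) atTop (𝓝 b))
    (hx : 0 ≤ x) : a * g₂ x < b * g₁ x := by
  have hd : ∀ y, 0 ≤ y → HasDerivAt (fun t => g₂ t / g₁ t)
      ((deriv g₂ y * g₁ y - g₂ y * deriv g₁ y) / g₁ y ^ 2) y := fun y hy =>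
    (hg₂.hasDerivAt_two y).1.div (hg₁.hasDerivAt_two y).1 (hpos y hy).ne'
  have hmono : StrictMonoOn (fun t => g₂ t / g₁ t) (Ici 0) := by
    refine strictMonoOn_of_deriv_pos (convex_Ici 0)
      (fun y hy => (hd y hy).continuousAt.continuousWithinAt) fun y hy => ?_
    have hy : 0 < y := by simpa using hy
    rw [(hd y hy.le).deriv]
    have h := hW y hy.le
    have h' := hpos y hy.le
    unfold Wron at h
    exact div_pos (by linarith) (by positivity)
  by_contra! hcon
  set q := g₂ (x + 1) / g₁ (x + 1) with hq
  have hbq : b / a < q := by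
    have h1 : b / a ≤ g₂ x / g₁ x := by
      rw [div_le_div_iff₀ ha (hpos x hx)]
      linarith
    exact h1.trans_lt (hmono hx (show (0:ℝ) ≤ x + 1 by linarith) (by linarith))
  have hlim : Tendsto (deriv (gb g₁ g₂ q)) atTop (𝓝 (b - q * a)) := by
    rw [show deriv (gb g₁ g₂ q) = gb' g₁ g₂ q from
      funext fun t => (hasDerivAt_gb hg₁ hg₂ q t).deriv]
    exact hgb.sub (hga.const_mul q)
  rw [div_lt_iff₀ ha] at hbq
  obtain ⟨y, hxy, hy⟩ := exists_lt_zero_of_tendsto_deriv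
    (fun t => (hasDerivAt_gb hg₁ hg₂ q t).differentiableAt) hlim (by linarith) (x + 1)
  have h0 : 0 ≤ y := by linarith
  have h := hmono.monotoneOn (show (0:ℝ) ≤ x + 1 by linarith) h0 hxy
  have h' : q ≤ g₂ y / g₁ y := h
  rw [le_div_iff₀ (hpos y h0)] at h'
  unfold gb at hy
  linarith

theorem deriv_deriv_eq_of_Lop_eq_zero {mu sig g : ℝ → ℝ} {lam x : ℝ} (hsig : 0 < sig x ^ 2)
    (h : Lop mu sig lam g x = 0) :
    deriv (deriv g) x = (lam * g x - mu x * deriv g x) / (sig x ^ 2 / 2) := by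
  unfold Lop at h
  rw [eq_div_iff (by positivity)]
  linarith

theorem exists_hasDerivAt_hfun {mu sig g₁ g₂ : ℝ → ℝ} {lam x : ℝ} (hlam : 0 < lam)
    (hmu : Differentiable ℝ mu) (hsig : ∀ x, 0 ≤ x → 0 < sig x ^ 2)
    (hg₁ : ContDiff ℝ 2 g₁) (hg₂ : ContDiff ℝ 2 g₂)
    (hL₁ : ∀ x, 0 ≤ x → Lop mu sig lam g₁ x = 0) (hL₂ : ∀ x, 0 ≤ x → Lop mu sig lam g₂ x = 0)
    (hW : 0 < Wron g₁ g₂ x) (hx : 0 < x) (hne : deriv (deriv g₁) x ≠ 0) :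
    ∃ c, 0 < c ∧ HasDerivAt (hfun g₁ g₂) (c * (lam - deriv mu x)) x := by
  have hs := hsig x hx.le
  have e₁ := deriv_deriv_eq_of_Lop_eq_zero hs (hL₁ x hx.le)
  have e₂ := deriv_deriv_eq_of_Lop_eq_zero hs (hL₂ x hx.le)
  have hN : lam * g₁ x - mu x * deriv g₁ x ≠ 0 := by
    intro h0
    exact hne (by rw [e₁, h0, zero_div])
  have hd : ∀ g : ℝ → ℝ, ContDiff ℝ 2 g → HasDerivAt (fun t => lam * g t - mu t * deriv g t)
      (lam * deriv g x - (deriv mu x * deriv g x + mu x * deriv (deriv g) x)) x := fun g hg =>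
    ((hg.hasDerivAt_two x).1.const_mul lam).sub
      ((hmu x).hasDerivAt.mul (hg.hasDerivAt_two x).2)
  have hev : hfun g₁ g₂ =ᶠ[𝓝 x] fun t =>
      (lam * g₂ t - mu t * deriv g₂ t) / (lam * g₁ t - mu t * deriv g₁ t) := by
    filter_upwards [lt_mem_nhds hx] with t ht
    have hst := hsig t ht.le
    unfold hfun
    rw [deriv_deriv_eq_of_Lop_eq_zero hst (hL₁ t ht.le),
      deriv_deriv_eq_of_Lop_eq_zero hst (hL₂ t ht.le), div_div_div_cancel_right₀ (by positivity)]
  refine ⟨lam * Wron g₁ g₂ x / (lam * g₁ x - mu x * deriv g₁ x) ^ 2, by positivity, ?_⟩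
  refine (((hd g₂ hg₂).div (hd g₁ hg₁) hN).congr_of_eventuallyEq hev).congr_deriv ?_
  rw [div_mul_eq_mul_div]
  congr 1
  have hc : deriv (deriv g₂) x * (lam * g₁ x - mu x * deriv g₁ x) =
      deriv (deriv g₁) x * (lam * g₂ x - mu x * deriv g₂ x) := by
    rw [e₁, e₂]
    ring
  unfold Wron
  linear_combination (-mu x) * hc

theorem hasDerivAt_gb'_comp {g₁ g₂ u : ℝ → ℝ} {c β u' : ℝ}
    (hg₁ : ContDiff ℝ 2 g₁) (hg₂ : ContDiff ℝ 2 g₂) (hu : HasDerivAt u u' β)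
    (hc : u β - c ≠ 0)
    (heq : ∀ᶠ t in 𝓝 β, gb g₁ g₂ t (u t) = (u t - c) * gb' g₁ g₂ t (u t)) :
    HasDerivAt (fun t => gb' g₁ g₂ t (u t)) (-g₁ (u β) / (u β - c)) β := by
  have hD := ((hg₂.hasDerivAt_two (u β)).2.comp β hu).sub
    ((hasDerivAt_id β).mul ((hg₁.hasDerivAt_two (u β)).2.comp β hu))
  have hN := ((hg₂.hasDerivAt_two (u β)).1.comp β hu).sub
    ((hasDerivAt_id β).mul ((hg₁.hasDerivAt_two (u β)).1.comp β hu))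
  have hP := ((hu.sub_const c).mul hD).congr_of_eventuallyEq heq
  have h := hN.unique hP
  refine hD.congr_deriv ?_
  rw [eq_div_iff hc]
  simp only [Pi.sub_apply, Pi.mul_apply, Function.comp_apply, id_eq] at h ⊢
  linear_combination -h

theorem stmt_17    (lam k K C xlam : ℝ) (mu sig : ℝ → ℝ)
    (hlam : 0 < lam) (hk : 0 < k) (hK : 0 < K) (hC : 0 < C)
    (hA1 : ∀ x : ℝ, 0 ≤ x → |mu x| + |sig x| ≤ C * (1 + x))
    (hA2mu : ContDiff ℝ 1 mu) (hA2sig : ContDiff ℝ 1 sig)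
    (hA2muL : ∃ M : NNReal, LipschitzWith M mu)
    (hA2sigL : ∃ M : NNReal, LipschitzWith M sig)
    (hA2muL' : ∃ M : NNReal, LipschitzWith M (deriv mu))
    (hA2sigL' : ∃ M : NNReal, LipschitzWith M (deriv sig))
    (hA3 : ∀ x : ℝ, 0 ≤ x → 0 < (sig x)^2)
    (hxlam : 0 ≤ xlam)
    (hA4a : ∀ x : ℝ, 0 ≤ x → x < xlam → lam < deriv mu x)
    (hA4b : ∀ x : ℝ, xlam ≤ x → deriv mu x ≤ lam)
    (g₁ g₂ : ℝ → ℝ)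
    (hg₁C : ContDiff ℝ 2 g₁) (hg₂C : ContDiff ℝ 2 g₂)
    (hg₁pos : ∀ x : ℝ, 0 ≤ x → 0 < g₁ x) (hg₂pos : ∀ x : ℝ, 0 ≤ x → 0 < g₂ x)
    (hg₁L : ∀ x : ℝ, 0 ≤ x → Lop mu sig lam g₁ x = 0)
    (hg₂L : ∀ x : ℝ, 0 ≤ x → Lop mu sig lam g₂ x = 0)
    (hg₁z : g₁ 0 = 1) (hg₂z : g₂ 0 = 1)
    (hg₁d : ∀ x : ℝ, 0 ≤ x → x < xlam → deriv g₁ x < 0)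
    (hg₁dx : deriv g₁ xlam = 0)
    (hg₁di : ∀ x : ℝ, xlam < x → 0 < deriv g₁ x)
    (hg₁dd : ∀ x : ℝ, xlam ≤ x → 0 < deriv (deriv g₁) x)
    (hg₂mono : StrictMonoOn g₂ (Ici (0:ℝ)))
    (hg₂d0 : 0 < deriv g₂ 0)
    (z₀ : ℝ) (hz₀ge : 0 ≤ z₀) (hz₀lt : z₀ < xlam)
    (hz₀eq : 0 ≤ deriv (deriv g₁) 0 → z₀ = 0)
    (hz₀a : ∀ x : ℝ, 0 < x → x < z₀ → deriv (deriv g₁) x < 0)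
    (hz₀b : ∀ x : ℝ, z₀ < x → x < xlam → 0 < deriv (deriv g₁) x)
    (hW : ∀ x : ℝ, 0 ≤ x → 0 < Wron g₁ g₂ x)
    (hgd : ∀ x : ℝ, 0 ≤ x → 0 < gb' g₁ g₂ 1 x)
    (x₁ : ℝ) (hx₁a : z₀ < x₁) (hx₁b : x₁ ≤ xlam)
    (hx₁c : ∀ x : ℝ, 0 ≤ x → x < x₁ → 0 < gb'' g₁ g₂ 1 x)
    (hx₁d : gb'' g₁ g₂ 1 x₁ = 0)
    (hmux : 0 < mu xlam * k - lam * (k * xlam - K))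
    (z : ℝ) (hza : x₁ < z) (hzb : z < xlam)
    (hzc : mu z * k - lam * (k * z - K) = 0)
    (hzd : ∀ x : ℝ, 0 ≤ x → x < z → mu x * k - lam * (k * x - K) < 0)
    (ubar : ℝ) (hubar0 : 0 < ubar) (hubar1 : ubar < x₁)
    (hubarg : gam k K g₁ g₂ 1 ubar = 0)
    (hinv : ℝ → ℝ)
    (hhinv : ∀ β : ℝ, hfun g₁ g₂ z ≤ β → β ≤ 1 →
      x₁ ≤ hinv β ∧ hinv β ≤ z ∧ hfun g₁ g₂ (hinv β) = β ∧
      (∀ y : ℝ, x₁ ≤ y → y ≤ z → hfun g₁ g₂ y = β → y = hinv β))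
    (u₁ : ℝ → ℝ)
    (hu₁cont : ContinuousOn u₁ (Icc (hfun g₁ g₂ z) 1))
    (hu₁cd : ContDiffOn ℝ 1 u₁ (Ioo (hfun g₁ g₂ z) 1))
    (hu₁anti : StrictAntiOn u₁ (Icc (hfun g₁ g₂ z) 1))
    (hu₁mem : ∀ β ∈ Icc (hfun g₁ g₂ z) 1, u₁ β ∈ Icc ubar z)
    (hu₁gam : ∀ β ∈ Icc (hfun g₁ g₂ z) 1, gam k K g₁ g₂ β (u₁ β) = 0)
    (hu₁l : u₁ (hfun g₁ g₂ z) = z) (hu₁r : u₁ 1 = ubar)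
    (hR7 : ∀ x : ℝ, xlam < x → gb'' g₁ g₂ 1 x ≤ 0)
    (a b : ℝ)
    (hga : Tendsto (deriv g₁) atTop (𝓝 a))
    (hgb : Tendsto (deriv g₂) atTop (𝓝 b))
    (hGgt : gb' g₁ g₂ 1 ubar < b - a)
    (hinfE : EReal)
    (hinfT : Tendsto (fun x : ℝ => ((hfun g₁ g₂ x : ℝ) : EReal)) atTop (𝓝 hinfE))
    (hcase :
      (hinfE ≤ ((hfun g₁ g₂ z : ℝ) : EReal)) ∨
      (∃ hi : ℝ, hinfE = ((hi : ℝ) : EReal) ∧ hfun g₁ g₂ z < hi ∧ hi < 1 ∧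
        (b - hi * a) / gb' g₁ g₂ hi (u₁ hi) ≤ 1)) :
    ∃ bh : ℝ,
      (hfun g₁ g₂ z < bh ∧ bh < 1 ∧
        (b - bh * a) / gb' g₁ g₂ bh (u₁ bh) = 1 ∧ u₁ bh < z) ∧
      ∀ b' : ℝ, hfun g₁ g₂ z < b' → b' < 1 →
        (b - b' * a) / gb' g₁ g₂ b' (u₁ b') = 1 → b' = bh := by
  have hz0 : 0 < z := by linarith
  have hdd : ∀ x, z₀ < x → 0 < deriv (deriv g₁) x := fun x hx =>
    (lt_or_ge x xlam).elim (hz₀b x hx) (hg₁dd x)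
  have hh : ∀ x, z₀ < x → ∃ c, 0 < c ∧ HasDerivAt (hfun g₁ g₂) (c * (lam - deriv mu x)) x :=
    fun x hx => exists_hasDerivAt_hfun hlam (hA2mu.differentiable (by norm_num)) hA3 hg₁C hg₂C
      hg₁L hg₂L (hW x (by linarith)) (by linarith) (hdd x hx).ne'
  have hh_cont : ContinuousOn (hfun g₁ g₂) (Ioi z₀) := fun x hx =>
    let ⟨_, _, h⟩ := hh x hx
    h.continuousAt.continuousWithinAt
  have hh_anti : StrictAntiOn (hfun g₁ g₂) (Icc x₁ xlam) := by
    refine strictAntiOn_of_deriv_neg (convex_Icc _ _)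
      (hh_cont.mono fun x hx => hx₁a.trans_le hx.1) fun x hx => ?_
    rw [interior_Icc] at hx
    obtain ⟨c, hc, hd⟩ := hh x (hx₁a.trans hx.1)
    rw [hd.deriv]
    exact mul_neg_of_pos_of_neg hc (sub_neg.2 (hA4a x (by linarith [hx.1]) hx.2))
  have hh_mono : MonotoneOn (hfun g₁ g₂) (Ici xlam) := by
    refine monotoneOn_of_deriv_nonneg (convex_Ici _)
      (hh_cont.mono fun x hx => hz₀lt.trans_le hx) (fun x hx => ?_) fun x hx => ?_
    all_goals
      rw [interior_Ici] at hx
      obtain ⟨c, hc, hd⟩ := hh x (hz₀lt.trans hx)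
    · exact hd.differentiableAt.differentiableWithinAt
    · rw [hd.deriv]
      exact mul_nonneg hc.le (sub_nonneg.2 (hA4b x (le_of_lt hx)))
  have hgb'' : ∀ β x, z₀ < x →
      gb'' g₁ g₂ β x = deriv (deriv g₁) x * (hfun g₁ g₂ x - β) := by
    intro β x hx
    unfold gb'' hfun
    have := (hdd x hx).ne'
    field_simp
  have hx₁h : hfun g₁ g₂ x₁ = 1 := by
    have h := hgb'' 1 x₁ hx₁a
    rw [hx₁d] at h
    rcases mul_eq_zero.1 h.symm with h | h
    · exact absurd h (hdd x₁ hx₁a).ne'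
    · linarith
  have hhz : hfun g₁ g₂ z < 1 :=
    hx₁h ▸ hh_anti ⟨le_rfl, hx₁b⟩ ⟨hza.le, hzb.le⟩ hza
  have ha : 0 < a := by
    have hmono : StrictMonoOn (deriv g₁) (Ici xlam) := by
      refine strictMonoOn_of_deriv_pos (convex_Ici _)
        (fun x _ => (hg₁C.hasDerivAt_two x).2.continuousAt.continuousWithinAt) fun x hx => ?_
      rw [interior_Ici] at hx
      exact hg₁dd x (le_of_lt hx)
    refine (hg₁di (xlam + 1) (by linarith)).trans_le (ge_of_tendsto hga ?_)
    filter_upwards [eventually_ge_atTop (xlam + 1)] with x hx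
    exact hmono.monotoneOn (show xlam ≤ xlam + 1 by linarith) (show xlam ≤ x by linarith) hx
  have hgam : ∀ β x, gb' g₁ g₂ β x ≠ 0 → gam k K g₁ g₂ β x = 0 →
      gb g₁ g₂ β x = (x - K / k) * gb' g₁ g₂ β x := by
    intro β x hne h
    unfold gam at h
    have h' : gb g₁ g₂ β x / gb' g₁ g₂ β x = x - K / k := by
      field_simp
      field_simp at h
      linarith
    rwa [div_eq_iff hne] at h'
  have hubarK : 0 < ubar - K / k := by
    have hmono : StrictMonoOn (gb g₁ g₂ 1) (Ici 0) := by
      refine strictMonoOn_of_deriv_pos (convex_Ici _)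
        (fun x _ => (hasDerivAt_gb hg₁C hg₂C 1 x).continuousAt.continuousWithinAt) fun x hx => ?_
      rw [interior_Ici] at hx
      rw [(hasDerivAt_gb hg₁C hg₂C 1 x).deriv]
      exact hgd x (le_of_lt hx)
    have h := hmono self_mem_Ici hubar0.le hubar0
    have hd := hgd ubar hubar0.le
    rw [hgam 1 ubar hd.ne' hubarg, show gb g₁ g₂ 1 0 = 0 by simp [gb, hg₁z, hg₂z]] at h
    exact pos_of_mul_pos_left h hd.le
  set I := Icc (hfun g₁ g₂ z) 1 with hI
  set D : ℝ → ℝ := fun β => gb' g₁ g₂ β (u₁ β) with hD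
  have hu_gt : ∀ β ∈ I, 0 < u₁ β - K / k := fun β hβ => by linarith [(hu₁mem β hβ).1]
  have hD_ne : ∀ β ∈ I, D β ≠ 0 := by
    intro β hβ h0
    have h := hu₁gam β hβ
    have hg : gb' g₁ g₂ β (u₁ β) = 0 := h0
    rw [gam, hg, div_zero] at h
    have := hu_gt β hβ
    rw [sub_pos, div_lt_iff₀ hk] at this
    linarith
  have hD_cont : ContinuousOn D I := by
    have hc : ∀ g : ℝ → ℝ, ContDiff ℝ 2 g → Continuous (deriv g) := fun g hg =>
      continuous_iff_continuousAt.2 fun x => (hg.hasDerivAt_two x).2.continuousAt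
    exact ((hc g₂ hg₂C).comp_continuousOn hu₁cont).sub
      (continuousOn_id.mul ((hc g₁ hg₁C).comp_continuousOn hu₁cont))
  have h1I : (1 : ℝ) ∈ I := ⟨hhz.le, le_rfl⟩
  have hD1 : D 1 = gb' g₁ g₂ 1 ubar := by simp only [hD, hu₁r]
  have hD_pos : ∀ β ∈ I, 0 < D β := by
    intro β hβ
    by_contra! hle
    have hsub : Icc β 1 ⊆ I := Icc_subset_Icc_left hβ.1
    obtain ⟨t, ht, ht0⟩ := intermediate_value_Icc hβ.2 (hD_cont.mono hsub)
      ⟨hle, hD1 ▸ (hgd ubar hubar0.le).le⟩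
    exact hD_ne t (hsub ht) ht0
  have hgbD : ∀ β ∈ I, gb g₁ g₂ β (u₁ β) = (u₁ β - K / k) * D β := fun β hβ =>
    hgam β _ (hD_ne β hβ) (hu₁gam β hβ)
  have hD_deriv : ∀ β ∈ Ioo (hfun g₁ g₂ z) 1,
      HasDerivAt D (-g₁ (u₁ β) / (u₁ β - K / k)) β := by
    intro β hβ
    have hnhds := Ioo_mem_nhds hβ.1 hβ.2
    refine hasDerivAt_gb'_comp hg₁C hg₂C
      ((hu₁cd.differentiableOn (by norm_num)).differentiableAt hnhds).hasDerivAt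
      (hu_gt β (Ioo_subset_Icc_self hβ)).ne' ?_
    filter_upwards [hnhds] with t ht using hgbD t (Ioo_subset_Icc_self ht)
  set G : ℝ → ℝ := fun β => (b - β * a) / D β with hG
  have hG_cont : ContinuousOn G I :=
    (continuousOn_const.sub (continuousOn_id.mul continuousOn_const)).div hD_cont hD_ne
  have hG_mono : StrictMonoOn G I := by
    refine strictMonoOn_of_deriv_pos (convex_Icc _ _) hG_cont fun β hβ => ?_
    rw [interior_Icc] at hβ
    have hβI := Ioo_subset_Icc_self hβ
    have hd := (((hasDerivAt_id β).mul_const a).const_sub b).div (hD_deriv β hβ) (hD_ne β hβI)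
    rw [show deriv G β = _ from hd.deriv]
    have hu0 : 0 ≤ u₁ β := hubar0.le.trans (hu₁mem β hβI).1
    have hlt := mul_lt_mul_of_wron_pos hg₁C hg₂C hg₁pos hW ha hga hgb hu0
    have hc := hu_gt β hβI
    refine div_pos ?_ (pow_pos (hD_pos β hβI) 2)
    have he : -(1 * a) * D β - (b - id β * a) * (-g₁ (u₁ β) / (u₁ β - K / k)) =
        (b * g₁ (u₁ β) - a * g₂ (u₁ β)) / (u₁ β - K / k) := by
      have := hgbD β hβI
      rw [gb] at this
      rw [eq_div_iff hc.ne', sub_mul, mul_assoc (b - id β * a), div_mul_cancel₀ _ hc.ne']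
      simp only [id_eq]
      linear_combination a * this
    rw [he]
    exact div_pos (by linarith) hc
  have hG1 : 1 < G 1 := by
    simp only [hG]
    rw [hD1, one_lt_div (hgd ubar hubar0.le)]
    linarith
  have hstart : ∃ β ∈ Ico (hfun g₁ g₂ z) 1, G β ≤ 1 ∧ G (hfun g₁ g₂ z) < 1 := by
    rcases hcase with hH1 | ⟨hi, -, hi1, hi2, hi3⟩
    · set β := hfun g₁ g₂ z with hβ
      suffices hlt : G β < 1 from ⟨β, ⟨le_rfl, hhz⟩, hlt.le, hlt⟩
      have hle : ∀ x, xlam ≤ x → hfun g₁ g₂ x ≤ β := by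
        intro x hx
        rw [← EReal.coe_le_coe_iff]
        refine le_trans (ge_of_tendsto hinfT ?_) hH1
        filter_upwards [eventually_ge_atTop x] with y hy
        exact EReal.coe_le_coe_iff.2 (hh_mono hx (hx.trans hy) hy)
      have hcont : Continuous (gb' g₁ g₂ β) :=
        continuous_iff_continuousAt.2 fun x => (hasDerivAt_gb' hg₁C hg₂C β x).continuousAt
      have hanti₁ : StrictAntiOn (gb' g₁ g₂ β) (Icc z xlam) := by
        refine strictAntiOn_of_deriv_neg (convex_Icc _ _) hcont.continuousOn fun x hx => ?_
        rw [interior_Icc] at hx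
        have hx0 : z₀ < x := by linarith [hx.1]
        rw [(hasDerivAt_gb' hg₁C hg₂C β x).deriv, hgb'' β x hx0]
        exact mul_neg_of_pos_of_neg (hdd x hx0) (sub_neg.2
          (hh_anti ⟨hza.le, hzb.le⟩ ⟨(hza.trans hx.1).le, hx.2.le⟩ hx.1))
      have hanti₂ : AntitoneOn (gb' g₁ g₂ β) (Ici xlam) := by
        refine antitoneOn_of_deriv_nonpos (convex_Ici _) hcont.continuousOn
          (fun x _ => (hasDerivAt_gb' hg₁C hg₂C β x).differentiableAt.differentiableWithinAt)
          fun x hx => ?_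
        rw [interior_Ici] at hx
        have hx0 : z₀ < x := hz₀lt.trans hx
        rw [(hasDerivAt_gb' hg₁C hg₂C β x).deriv, hgb'' β x hx0]
        exact mul_nonpos_of_nonneg_of_nonpos (hdd x hx0).le (sub_nonpos.2 (hle x (le_of_lt hx)))
      have hlim : b - β * a ≤ gb' g₁ g₂ β xlam := by
        refine le_of_tendsto (hgb.sub (hga.const_mul β)) ?_
        filter_upwards [eventually_ge_atTop xlam] with x hx
        exact hanti₂ self_mem_Ici hx hx
      have hDz : D β = gb' g₁ g₂ β z := by simp only [hD, hu₁l]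
      have hlt := hanti₁ ⟨le_rfl, hzb.le⟩ ⟨hzb.le, le_rfl⟩ hzb
      simp only [hG]
      rw [div_lt_one (hD_pos β ⟨le_rfl, hhz.le⟩), hDz]
      linarith
    · exact ⟨hi, ⟨hi1.le, hi2⟩, hi3,
        (hG_mono ⟨le_rfl, hhz.le⟩ ⟨hi1.le, hi2.le⟩ hi1).trans_le hi3⟩
  obtain ⟨β₀, hβ₀, hGβ₀, hGz⟩ := hstart
  obtain ⟨bh, hbh, hGbh⟩ := intermediate_value_Icc hβ₀.2.le
    (hG_cont.mono (Icc_subset_Icc_left hβ₀.1)) ⟨hGβ₀, hG1.le⟩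
  have hbhI : bh ∈ I := ⟨hβ₀.1.trans hbh.1, hbh.2⟩
  have hlt : hfun g₁ g₂ z < bh :=
    lt_of_le_of_ne hbhI.1 fun h => hGz.ne (h ▸ hGbh)
  have hlt1 : bh < 1 :=
    lt_of_le_of_ne hbh.2 fun h => hG1.ne' (h ▸ hGbh)
  refine ⟨bh, ⟨hlt, hlt1, hGbh, ?_⟩, fun b' h1 h2 h3 => ?_⟩
  · have h := hu₁anti ⟨le_rfl, hhz.le⟩ hbhI hlt
    rwa [hu₁l] at h
  · exact hG_mono.injOn ⟨h1.le, h2.le⟩ hbhI (h3.trans hGbh.symm)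
end

section
/- Define MV(x) = sup{ V(z) + k(x − z) − K : 0 ≤ z ≤ x }. Then MV(x) = V(x) for x ∈ [ū*,ũ₁] ∪ [ũ₃,∞), and MV(x) < V(x) for x ∈ (0,ū*) ∪ (ũ₁,ũ₃). -/
open Set Filter Topology

noncomputable def Vfun (k K cstar ctil bt ubar u1t u3t : ℝ) (g₁ g₂ : ℝ → ℝ) (x : ℝ) : ℝ :=
  if x < ubar then cstar * gb g₁ g₂ 1 x
  else if x < u1t then k * x - K
  else if x < u3t then ctil * gb g₁ g₂ bt x
  else k * x - K

noncomputable def Mop (k K : ℝ) (V : ℝ → ℝ) (x : ℝ) : ℝ :=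
  sSup ((fun z' => V z' + k * (x - z') - K) '' Icc 0 x)

/-- Dividing the generator's zeroth and first order part by the Wronskian gives a function whose
derivative has the sign of `lam` minus the derivative of `mu`. -/
theorem hasDerivAt_sub_mul_div_wronskian {f f₁ mu W : ℝ → ℝ} {f₂ m w s lam x : ℝ}
    (hf : HasDerivAt f (f₁ x) x) (hf₁ : HasDerivAt f₁ f₂ x) (hmu : HasDerivAt mu m x)
    (hW : HasDerivAt W w x) (hWx : 0 < W x)
    (hode : (1/2) * s ^ 2 * f₂ + mu x * f₁ x - lam * f x = 0)
    (hw : (1/2) * s ^ 2 * w = -(mu x * W x)) :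
    HasDerivAt (fun y => (lam * f y - mu y * f₁ y) / W y) ((lam - m) * f₁ x / W x) x := by
  have h := ((hf.const_mul lam).sub (hmu.mul hf₁)).div hW hWx.ne'
  refine h.congr_deriv ?_
  have key : (lam * f x - mu x * f₁ x) * w = -(mu x * W x * f₂) := by
    linear_combination (-w) * hode + f₂ * hw
  simp only [Pi.sub_apply, Pi.mul_apply]
  rw [key]
  field_simp
  ring

/-- A positive solution of the second order equation which is increasing at `a` stays increasing. -/
theorem deriv_pos_of_ode {f f₁ f₂ mu sig : ℝ → ℝ} {lam a : ℝ} (hlam : 0 < lam)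
    (hf₁ : ∀ x, HasDerivAt f₁ (f₂ x) x) (hpos : ∀ x, a ≤ x → 0 < f x)
    (hode : ∀ x, a ≤ x → (1/2) * sig x ^ 2 * f₂ x + mu x * f₁ x - lam * f x = 0)
    (ha : 0 < f₁ a) {x : ℝ} (hx : a ≤ x) : 0 < f₁ x := by
  by_contra! hneg
  have hcont : Continuous f₁ := continuous_iff_continuousAt.2 fun y => (hf₁ y).continuousAt
  have hclosed : IsCompact (Icc a x ∩ {y | f₁ y ≤ 0}) :=
    isCompact_Icc.inter_right (isClosed_le hcont continuous_const)
  obtain ⟨t, ⟨⟨hat, htx⟩, ht0⟩, hmin⟩ := hclosed.exists_isLeast ⟨x, ⟨hx, le_rfl⟩, hneg⟩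
  have ht0 : f₁ t ≤ 0 := ht0
  have hlt : a < t := lt_of_le_of_ne hat fun h => by subst h; linarith
  have hbefore : ∀ y, a ≤ y → y < t → 0 < f₁ y := fun y hay hyt => by
    by_contra! h
    exact absurd (hmin ⟨⟨hay, hyt.le.trans htx⟩, h⟩) (not_le.2 hyt)
  have hev : ∀ᶠ y in 𝓝[<] t, 0 < f₁ y := by
    filter_upwards [Ioo_mem_nhdsLT hlt] with y hy using hbefore y hy.1.le hy.2
  have hzero : f₁ t = 0 := le_antisymm ht0 <|
    ge_of_tendsto ((hf₁ t).continuousAt.tendsto.mono_left nhdsWithin_le_nhds)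
      (hev.mono fun _ h => h.le)
  have hft := hpos t hat
  have h2 : 0 < f₂ t := by
    have h := hode t hat
    rw [hzero] at h
    by_contra! h'
    nlinarith [mul_pos hlam hft, mul_nonneg (sq_nonneg (sig t)) (neg_nonneg.2 h')]
  have hslope : Tendsto (slope f₁ t) (𝓝[<] t) (𝓝 (f₂ t)) :=
    (hasDerivAt_iff_tendsto_slope.1 (hf₁ t)).mono_left
      (nhdsWithin_mono t fun y (hy : y < t) => ne_of_lt hy)
  obtain ⟨y, hslope_pos, hy_pos, hyt⟩ :=
    ((hslope.eventually (lt_mem_nhds h2)).and (hev.and self_mem_nhdsWithin)).exists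
  have hyt : y < t := hyt
  rw [slope_def_field, hzero] at hslope_pos
  exact absurd hslope_pos
    (not_lt.2 (div_nonpos_of_nonneg_of_nonpos (by linarith) (by linarith)))

/-- Let the second derivative of `f` have the sign of `Q`, which decreases strictly up to `c`,
increases weakly after `c` and vanishes at `m < c < p`. If the derivative of `f` takes the same
value at `a`, `b` and `e`, where `a < m < b < p < e`, and the chord of `f` over `[a, e]` has that
slope, then on `(a, e)` the function `f` lies strictly above the chord, furthest at `b`. -/
theorem chord_bounds {f f₁ f₂ Q : ℝ → ℝ} {a m b p e c : ℝ}
    (hf : ∀ x, HasDerivAt f (f₁ x) x) (hf₁ : ∀ x, HasDerivAt f₁ (f₂ x) x)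
    (ham : a < m) (hmb : m < b) (hbp : b < p) (hpe : p < e) (hmc : m < c) (hcp : c < p)
    (hQanti : StrictAntiOn Q (Icc a c)) (hQmono : MonotoneOn Q (Ici c))
    (hsgn : ∀ x, a ≤ x → ∃ r, 0 < r ∧ f₂ x = r * Q x)
    (hQm : Q m = 0) (hQp : Q p = 0)
    (hb : f₁ b = f₁ a) (he : f₁ e = f₁ a) (hchord : f e - f₁ a * e = f a - f₁ a * a) :
    ∀ x ∈ Ioo a e, f a - f₁ a * a < f x - f₁ a * x ∧ f x - f₁ a * x ≤ f b - f₁ a * b := by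
  have hcf₁ : Continuous f₁ := continuous_iff_continuousAt.2 fun y => (hf₁ y).continuousAt
  have hpos : ∀ {x}, a ≤ x → 0 < Q x → 0 < f₂ x := fun {x} hx h => by
    obtain ⟨r, hr, hrx⟩ := hsgn x hx; rw [hrx]; exact mul_pos hr h
  have hnn : ∀ {x}, a ≤ x → 0 ≤ Q x → 0 ≤ f₂ x := fun {x} hx h => by
    obtain ⟨r, hr, hrx⟩ := hsgn x hx; rw [hrx]; exact mul_nonneg hr.le h
  have hnp : ∀ {x}, a ≤ x → Q x ≤ 0 → f₂ x ≤ 0 := fun {x} hx h => by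
    obtain ⟨r, hr, hrx⟩ := hsgn x hx; rw [hrx]; exact mul_nonpos_of_nonneg_of_nonpos hr.le h
  have hinc : StrictMonoOn f₁ (Icc a m) := by
    refine strictMonoOn_of_deriv_pos (convex_Icc _ _) hcf₁.continuousOn fun x hx => ?_
    rw [interior_Icc] at hx
    rw [(hf₁ x).deriv]
    refine hpos hx.1.le ?_
    rw [← hQm]
    exact hQanti ⟨hx.1.le, (hx.2.trans hmc).le⟩ ⟨ham.le, hmc.le⟩ hx.2
  have hdec : AntitoneOn f₁ (Icc m p) := by
    refine antitoneOn_of_deriv_nonpos (convex_Icc _ _) hcf₁.continuousOn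
      (fun x _ => (hf₁ x).differentiableAt.differentiableWithinAt) fun x hx => ?_
    rw [interior_Icc] at hx
    rw [(hf₁ x).deriv]
    refine hnp (ham.trans hx.1).le ?_
    rcases le_total x c with hxc | hxc
    · rw [← hQm]
      exact (hQanti ⟨ham.le, hmc.le⟩ ⟨(ham.trans hx.1).le, hxc⟩ hx.1).le
    · rw [← hQp]
      exact hQmono hxc hcp.le hx.2.le
  have hQtail : ∀ {x}, p ≤ x → 0 ≤ Q x := fun {x} hx => by
    rw [← hQp]; exact hQmono hcp.le (hcp.le.trans hx) hx
  have hinc' : MonotoneOn f₁ (Ici p) := by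
    refine monotoneOn_of_deriv_nonneg (convex_Ici _) hcf₁.continuousOn
      (fun x _ => (hf₁ x).differentiableAt.differentiableWithinAt) fun x hx => ?_
    rw [interior_Ici] at hx
    have hx : p < x := hx
    rw [(hf₁ x).deriv]
    exact hnn (by linarith) (hQtail hx.le)
  have hD : ∀ x, HasDerivAt (fun y => f y - f₁ a * y) (f₁ x - f₁ a) x := fun x =>
    ((hf x).sub ((hasDerivAt_id x).const_mul (f₁ a))).congr_deriv (by rw [mul_one])
  set D : ℝ → ℝ := fun y => f y - f₁ a * y with hDdef
  have hDc : Continuous D := continuous_iff_continuousAt.2 fun y => (hD y).continuousAt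
  have hDdiff : Differentiable ℝ D := fun y => (hD y).differentiableAt
  have hD1 : StrictMonoOn D (Icc a m) := by
    refine strictMonoOn_of_deriv_pos (convex_Icc _ _) hDc.continuousOn fun x hx => ?_
    rw [interior_Icc] at hx
    rw [(hD x).deriv, sub_pos]
    exact hinc ⟨le_rfl, ham.le⟩ ⟨hx.1.le, hx.2.le⟩ hx.1
  have hD2 : MonotoneOn D (Icc m b) := by
    refine monotoneOn_of_deriv_nonneg (convex_Icc _ _) hDc.continuousOn
      hDdiff.differentiableOn fun x hx => ?_
    rw [interior_Icc] at hx
    rw [(hD x).deriv, sub_nonneg, ← hb]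
    exact hdec ⟨hx.1.le, (hx.2.trans hbp).le⟩ ⟨hmb.le, hbp.le⟩ hx.2.le
  have hle3 : ∀ x ∈ Icc b p, f₁ x ≤ f₁ a := fun x hx => by
    rw [← hb]
    exact hdec ⟨hmb.le, hbp.le⟩ ⟨hmb.le.trans hx.1, hx.2⟩ hx.1
  have hle4 : ∀ x ∈ Icc p e, f₁ x ≤ f₁ a := fun x hx => by
    rw [← he]; exact hinc' hx.1 hpe.le hx.2
  have hD3 : AntitoneOn D (Icc b p) := by
    refine antitoneOn_of_deriv_nonpos (convex_Icc _ _) hDc.continuousOn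
      hDdiff.differentiableOn fun x hx => ?_
    rw [interior_Icc] at hx
    rw [(hD x).deriv, sub_nonpos]
    exact hle3 x ⟨hx.1.le, hx.2.le⟩
  have hDab : D a < D b :=
    (hD1 ⟨le_rfl, ham.le⟩ ⟨ham.le, le_rfl⟩ ham).trans_le (hD2 ⟨le_rfl, hmb.le⟩ ⟨hmb.le, le_rfl⟩ hmb.le)
  have hfp : f₁ p < f₁ a := by
    refine lt_of_le_of_ne (hle3 p ⟨hbp.le, le_rfl⟩) fun heq => ?_
    have hDmono : MonotoneOn D (Icc b e) := by
      refine monotoneOn_of_deriv_nonneg (convex_Icc _ _) hDc.continuousOn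
        hDdiff.differentiableOn fun x hx => ?_
      rw [interior_Icc] at hx
      rw [(hD x).deriv, sub_nonneg, ← heq]
      rcases le_total x p with hxp | hxp
      · exact hdec ⟨(hmb.trans hx.1).le, hxp⟩ ⟨(hmb.trans hbp).le, le_rfl⟩ hxp
      · exact hinc' self_mem_Ici hxp hxp
    have hbe := hbp.trans hpe
    have : D b ≤ D e := hDmono ⟨le_rfl, hbe.le⟩ ⟨hbe.le, le_rfl⟩ hbe.le
    have : D e = D a := hchord
    linarith
  have hlt4 : ∀ x ∈ Ico p e, f₁ x < f₁ a := fun x hx => by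
    refine lt_of_le_of_ne (hle4 x ⟨hx.1, hx.2.le⟩) fun heq => ?_
    have hpx : p < x := lt_of_le_of_ne hx.1 fun h => by rw [← h] at heq; exact hfp.ne heq
    obtain ⟨v, hv, hveq⟩ := exists_hasDerivAt_eq_slope f₁ f₂ hpx hcf₁.continuousOn
      fun y _ => hf₁ y
    obtain ⟨w, hw, hweq⟩ := exists_hasDerivAt_eq_slope f₁ f₂ hx.2 hcf₁.continuousOn
      fun y _ => hf₁ y
    have hv2 : 0 < f₂ v := by
      rw [hveq]; exact div_pos (by linarith) (by linarith)
    have hw2 : f₂ w = 0 := by rw [hweq, he, heq]; simp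
    have hav : a ≤ v := by linarith [hv.1]
    have haw : a ≤ w := by linarith [hw.1]
    have hvw : Q v ≤ Q w :=
      hQmono (hcp.le.trans hv.1.le) (by show c ≤ w; linarith [hw.1]) (hv.2.trans hw.1).le
    have hQv : 0 < Q v := by
      by_contra! h
      exact absurd hv2 (not_lt.2 (hnp hav h))
    exact absurd hw2 (hpos haw (hQv.trans_le hvw)).ne'
  have hD4 : StrictAntiOn D (Icc p e) := by
    refine strictAntiOn_of_deriv_neg (convex_Icc _ _) hDc.continuousOn fun x hx => ?_
    rw [interior_Icc] at hx
    rw [(hD x).deriv, sub_neg]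
    exact hlt4 x ⟨hx.1.le, hx.2⟩
  have hDp : D e < D p := hD4 ⟨le_rfl, hpe.le⟩ ⟨hpe.le, le_rfl⟩ hpe
  have hDe : D e = D a := hchord
  have hDpb : D p ≤ D b := hD3 ⟨le_rfl, hbp.le⟩ ⟨hbp.le, le_rfl⟩ hbp.le
  have hDmb : D m ≤ D b := hD2 ⟨le_rfl, hmb.le⟩ ⟨hmb.le, le_rfl⟩ hmb.le
  have hDam : D a < D m := hD1 ⟨le_rfl, ham.le⟩ ⟨ham.le, le_rfl⟩ ham
  intro x hx
  change D a < D x ∧ D x ≤ D b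
  rcases le_total x m with h1 | h1
  · exact ⟨hD1 ⟨le_rfl, ham.le⟩ ⟨hx.1.le, h1⟩ hx.1,
      (hD1.monotoneOn ⟨hx.1.le, h1⟩ ⟨ham.le, le_rfl⟩ h1).trans hDmb⟩
  rcases le_total x b with h2 | h2
  · exact ⟨hDam.trans_le (hD2 ⟨le_rfl, hmb.le⟩ ⟨h1, h2⟩ h1), hD2 ⟨h1, h2⟩ ⟨hmb.le, le_rfl⟩ h2⟩
  rcases le_total x p with h3 | h3
  · exact ⟨by linarith [hD3 ⟨h2, h3⟩ ⟨hbp.le, le_rfl⟩ h3], hD3 ⟨le_rfl, hbp.le⟩ ⟨h2, h3⟩ h2⟩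
  · exact ⟨hDe ▸ hD4 ⟨h3, hx.2.le⟩ ⟨hpe.le, le_rfl⟩ hx.2,
      (hD4.antitoneOn ⟨le_rfl, hpe.le⟩ ⟨h3, hx.2.le⟩ h3).trans hDpb⟩

/-- If the reward net of proportional gain peaks at the origin, a single lump sum down to `0` is
the best intervention. -/
theorem Mop_eq_of_net_nonpos {k K : ℝ} {V : ℝ → ℝ} (h0 : V 0 = 0)
    (hle : ∀ y, 0 ≤ y → V y ≤ k * y) {x : ℝ} (hx : 0 ≤ x) : Mop k K V x = k * x - K := by
  refine IsGreatest.csSup_eq ⟨⟨0, ⟨le_rfl, hx⟩, by simp [h0]⟩, ?_⟩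
  rintro _ ⟨y, hy, rfl⟩
  have := hle y hy.1
  dsimp only
  linarith

theorem stmt_19    (lam k K C xlam : ℝ) (mu sig : ℝ → ℝ)
    (hlam : 0 < lam) (hk : 0 < k) (hK : 0 < K) (hC : 0 < C)
    (hA1 : ∀ x : ℝ, 0 ≤ x → |mu x| + |sig x| ≤ C * (1 + x))
    (hA2mu : ContDiff ℝ 1 mu) (hA2sig : ContDiff ℝ 1 sig)
    (hA2muL : ∃ M : NNReal, LipschitzWith M mu)
    (hA2sigL : ∃ M : NNReal, LipschitzWith M sig)
    (hA2muL' : ∃ M : NNReal, LipschitzWith M (deriv mu))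
    (hA2sigL' : ∃ M : NNReal, LipschitzWith M (deriv sig))
    (hA3 : ∀ x : ℝ, 0 ≤ x → 0 < (sig x)^2)
    (hxlam : 0 ≤ xlam)
    (hA4a : ∀ x : ℝ, 0 ≤ x → x < xlam → lam < deriv mu x)
    (hA4b : ∀ x : ℝ, xlam ≤ x → deriv mu x ≤ lam)
    (g₁ g₂ : ℝ → ℝ)
    (hg₁C : ContDiff ℝ 2 g₁) (hg₂C : ContDiff ℝ 2 g₂)
    (hg₁pos : ∀ x : ℝ, 0 ≤ x → 0 < g₁ x) (hg₂pos : ∀ x : ℝ, 0 ≤ x → 0 < g₂ x)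
    (hg₁L : ∀ x : ℝ, 0 ≤ x → Lop mu sig lam g₁ x = 0)
    (hg₂L : ∀ x : ℝ, 0 ≤ x → Lop mu sig lam g₂ x = 0)
    (hg₁z : g₁ 0 = 1) (hg₂z : g₂ 0 = 1)
    (hg₁d : ∀ x : ℝ, 0 ≤ x → x < xlam → deriv g₁ x < 0)
    (hg₁dx : deriv g₁ xlam = 0)
    (hg₁di : ∀ x : ℝ, xlam < x → 0 < deriv g₁ x)
    (hg₁dd : ∀ x : ℝ, xlam ≤ x → 0 < deriv (deriv g₁) x)
    (hg₂mono : StrictMonoOn g₂ (Ici (0:ℝ)))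
    (hg₂d0 : 0 < deriv g₂ 0)
    (z₀ : ℝ) (hz₀ge : 0 ≤ z₀) (hz₀lt : z₀ < xlam)
    (hz₀eq : 0 ≤ deriv (deriv g₁) 0 → z₀ = 0)
    (hz₀a : ∀ x : ℝ, 0 < x → x < z₀ → deriv (deriv g₁) x < 0)
    (hz₀b : ∀ x : ℝ, z₀ < x → x < xlam → 0 < deriv (deriv g₁) x)
    (hW : ∀ x : ℝ, 0 ≤ x → 0 < Wron g₁ g₂ x)
    (hgd : ∀ x : ℝ, 0 ≤ x → 0 < gb' g₁ g₂ 1 x)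
    (x₁ : ℝ) (hx₁a : z₀ < x₁) (hx₁b : x₁ ≤ xlam)
    (hx₁c : ∀ x : ℝ, 0 ≤ x → x < x₁ → 0 < gb'' g₁ g₂ 1 x)
    (hx₁d : gb'' g₁ g₂ 1 x₁ = 0)
    (hmux : 0 < mu xlam * k - lam * (k * xlam - K))
    (z : ℝ) (hza : x₁ < z) (hzb : z < xlam)
    (hzc : mu z * k - lam * (k * z - K) = 0)
    (hzd : ∀ x : ℝ, 0 ≤ x → x < z → mu x * k - lam * (k * x - K) < 0)
    (ubar : ℝ) (hubar0 : 0 < ubar) (hubar1 : ubar < x₁)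
    (hubarg : gam k K g₁ g₂ 1 ubar = 0)
    (hinv : ℝ → ℝ)
    (hhinv : ∀ β : ℝ, hfun g₁ g₂ z ≤ β → β ≤ 1 →
      x₁ ≤ hinv β ∧ hinv β ≤ z ∧ hfun g₁ g₂ (hinv β) = β ∧
      (∀ y : ℝ, x₁ ≤ y → y ≤ z → hfun g₁ g₂ y = β → y = hinv β))
    (bt : ℝ) (hbt1 : hfun g₁ g₂ z < bt) (hbt2 : bt < 1)
    (xp : ℝ) (hxp1 : xlam < xp) (hxp2 : hfun g₁ g₂ xp = bt)
    (u1t : ℝ) (hu1ta : ubar < u1t) (hu1tb : u1t < hinv bt)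
    (hu1tg : gam k K g₁ g₂ bt u1t = 0)
    (u3t : ℝ) (hu3ta : xp < u3t)
    (hu3tb : gb' g₁ g₂ bt u3t = gb' g₁ g₂ bt u1t)
    (u2t : ℝ) (hu2ta : hinv bt < u2t) (hu2tb : u2t < xp)
    (hu2tc : gb' g₁ g₂ bt u2t = gb' g₁ g₂ bt u1t)
    (hJ12 : -Jfun k g₁ g₂ bt u1t u2t = Jfun k g₁ g₂ bt u2t u3t)
    (hJ2K : Jfun k g₁ g₂ bt u2t u3t ≤ K)
    (hJ13 : Jfun k g₁ g₂ bt u1t u3t = 0)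
    (cstar ctil : ℝ) (V : ℝ → ℝ)
    (hcstar : cstar = k / gb' g₁ g₂ 1 ubar)
    (hctil : ctil = k / gb' g₁ g₂ bt u1t)
    (hV : V = Vfun k K cstar ctil bt ubar u1t u3t g₁ g₂) :
    (∀ x ∈ Icc ubar u1t ∪ Ici u3t, Mop k K V x = V x) ∧
    (∀ x ∈ Ioo 0 ubar ∪ Ioo u1t u3t, Mop k K V x < V x) := by
  subst hV hcstar hctil
  have hd1 : ∀ {g : ℝ → ℝ}, ContDiff ℝ 2 g → ∀ x, HasDerivAt g (deriv g x) x :=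
    fun hg x => (hg.differentiable (by norm_num) x).hasDerivAt
  have hd2 : ∀ {g : ℝ → ℝ}, ContDiff ℝ 2 g → ∀ x, HasDerivAt (deriv g) (deriv (deriv g) x) x :=
    fun hg x => ((hg.differentiable_deriv_two) x).hasDerivAt
  have hgb : ∀ β x, HasDerivAt (gb g₁ g₂ β) (gb' g₁ g₂ β x) x := fun β x =>
    (hd1 hg₂C x).sub ((hd1 hg₁C x).const_mul β)
  have hgb' : ∀ β x, HasDerivAt (gb' g₁ g₂ β) (gb'' g₁ g₂ β x) x := fun β x =>
    (hd2 hg₂C x).sub ((hd2 hg₁C x).const_mul β)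
  have hode : ∀ β x, 0 ≤ x → (1/2) * sig x ^ 2 * gb'' g₁ g₂ β x + mu x * gb' g₁ g₂ β x
      - lam * gb g₁ g₂ β x = 0 := fun β x hx => by
    have h1 := hg₁L x hx
    have h2 := hg₂L x hx
    unfold Lop at h1 h2
    unfold gb gb' gb''
    linear_combination h2 - β * h1
  have hWd : ∀ x, HasDerivAt (Wron g₁ g₂)
      (g₁ x * deriv (deriv g₂) x - g₂ x * deriv (deriv g₁) x) x := fun x => by
    refine (((hd1 hg₁C x).mul (hd2 hg₂C x)).sub ((hd1 hg₂C x).mul (hd2 hg₁C x))).congr_deriv ?_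
    ring
  have hWode : ∀ x, 0 ≤ x → (1/2) * sig x ^ 2 *
      (g₁ x * deriv (deriv g₂) x - g₂ x * deriv (deriv g₁) x) = -(mu x * Wron g₁ g₂ x) :=
    fun x hx => by
      have h1 := hg₁L x hx
      have h2 := hg₂L x hx
      unfold Lop at h1 h2
      unfold Wron
      linear_combination g₁ x * h2 - g₂ x * h1
  have hgmono : StrictMonoOn (gb g₁ g₂ 1) (Ici 0) := by
    refine strictMonoOn_of_deriv_pos (convex_Ici _)
      (fun x _ => (hgb 1 x).continuousAt.continuousWithinAt) fun x hx => ?_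
    rw [interior_Ici] at hx
    rw [(hgb 1 x).deriv]
    exact hgd x (le_of_lt hx)
  have hg0 : gb g₁ g₂ 1 0 = 0 := by simp [gb, hg₁z, hg₂z]
  have hfpos : ∀ x, 0 ≤ x → 0 < gb g₁ g₂ bt x := fun x hx => by
    have h1 : gb g₁ g₂ 1 0 ≤ gb g₁ g₂ 1 x := hgmono.monotoneOn self_mem_Ici hx hx
    have h2 := mul_pos (sub_pos.2 hbt2) (hg₁pos x hx)
    rw [hg0] at h1
    unfold gb at h1 ⊢
    linarith
  have hu1 : 0 < u1t := hubar0.trans hu1ta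
  have hd0 := hgd ubar hubar0.le
  have hgubar : k * (gb g₁ g₂ 1 ubar / gb' g₁ g₂ 1 ubar) = k * ubar - K := by
    unfold gam at hubarg; linarith
  have hkubar : 0 < k * ubar - K := by
    rw [← hgubar]
    have : 0 < gb g₁ g₂ 1 ubar := hg0 ▸ hgmono self_mem_Ici hubar0.le hubar0
    positivity
  have hgu1 : k * (gb g₁ g₂ bt u1t / gb' g₁ g₂ bt u1t) = k * u1t - K := by
    unfold gam at hu1tg; linarith
  have hd : 0 < gb' g₁ g₂ bt u1t := by
    by_contra! h
    have h1 : k * (gb g₁ g₂ bt u1t / gb' g₁ g₂ bt u1t) ≤ 0 :=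
      mul_nonpos_of_nonneg_of_nonpos hk.le
        (div_nonpos_of_nonneg_of_nonpos (hfpos u1t hu1.le).le h)
    nlinarith
  have hfd : ∀ x, u1t ≤ x → 0 < gb' g₁ g₂ bt x := fun x hx =>
    deriv_pos_of_ode hlam (hgb' bt) (fun y hy => hfpos y (hu1.le.trans hy))
      (fun y hy => hode bt y (hu1.le.trans hy)) hd hx
  set Q : ℝ → ℝ := fun y => (lam * gb g₁ g₂ bt y - mu y * gb' g₁ g₂ bt y) / Wron g₁ g₂ y
    with hQdef
  have hQd : ∀ x, 0 ≤ x →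
      HasDerivAt Q ((lam - deriv mu x) * gb' g₁ g₂ bt x / Wron g₁ g₂ x) x := fun x hx =>
    hasDerivAt_sub_mul_div_wronskian (hgb bt x) (hgb' bt x)
      (hA2mu.differentiable (by norm_num) x).hasDerivAt (hWd x) (hW x hx)
      (hode bt x hx) (hWode x hx)
  have hQsgn : ∀ x, u1t ≤ x → ∃ r, 0 < r ∧ gb'' g₁ g₂ bt x = r * Q x := fun x hx => by
    have hx0 := hu1.le.trans hx
    have hs := hA3 x hx0
    have hw := hW x hx0
    refine ⟨2 * Wron g₁ g₂ x / sig x ^ 2, by positivity, ?_⟩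
    have h := hode bt x hx0
    simp only [hQdef]
    rw [div_mul_div_comm, eq_div_iff (by positivity)]
    linear_combination (2 * Wron g₁ g₂ x) * h
  obtain ⟨hm1, hm2, hm3, -⟩ := hhinv bt hbt1.le hbt2.le
  set m := hinv bt
  have hmx : m < xlam := hm2.trans_lt hzb
  have hQzero : ∀ x, u1t ≤ x → 0 < deriv (deriv g₁) x → hfun g₁ g₂ x = bt → Q x = 0 :=
    fun x hx h1 h2 => by
      obtain ⟨r, hr, hrx⟩ := hQsgn x hx
      unfold hfun at h2
      rw [div_eq_iff h1.ne'] at h2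
      have : gb'' g₁ g₂ bt x = 0 := by unfold gb''; linarith
      rw [this] at hrx
      exact (mul_eq_zero.1 hrx.symm).resolve_left hr.ne'
  have hux : u1t < xlam := hu1tb.trans hmx
  have hQanti : StrictAntiOn Q (Icc u1t xlam) := by
    refine strictAntiOn_of_deriv_neg (convex_Icc _ _)
      (fun x hx => (hQd x (hu1.le.trans hx.1)).continuousAt.continuousWithinAt) fun x hx => ?_
    rw [interior_Icc] at hx
    have hx0 := (hu1.trans hx.1).le
    rw [(hQd x hx0).deriv]
    exact div_neg_of_neg_of_pos
      (mul_neg_of_neg_of_pos (sub_neg.2 (hA4a x hx0 hx.2)) (hfd x hx.1.le)) (hW x hx0)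
  have hQmono : MonotoneOn Q (Ici xlam) := by
    have hx0 : ∀ x, xlam ≤ x → 0 ≤ x := fun x hx => hxlam.trans hx
    refine monotoneOn_of_deriv_nonneg (convex_Ici _)
      (fun x hx => (hQd x (hx0 x hx)).continuousAt.continuousWithinAt)
      (fun x hx => (hQd x (hx0 x (interior_subset hx))).differentiableAt.differentiableWithinAt)
      fun x hx => ?_
    have hx : xlam ≤ x := interior_subset hx
    rw [(hQd x (hx0 x hx)).deriv]
    exact div_nonneg (mul_nonneg (sub_nonneg.2 (hA4b x hx)) (hfd x (hux.le.trans hx)).le)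
      (hW x (hx0 x hx)).le
  have hu13 : u1t < u3t := by linarith
  have hchord : gb g₁ g₂ bt u3t - gb' g₁ g₂ bt u1t * u3t
      = gb g₁ g₂ bt u1t - gb' g₁ g₂ bt u1t * u1t := by
    unfold Jfun at hJ13
    rw [hu3tb] at hJ13
    have h := (mul_eq_zero.1 hJ13).resolve_left hk.ne'
    rw [sub_eq_zero, eq_div_iff hd.ne'] at h
    linarith
  have hbounds := chord_bounds (hgb bt) (hgb' bt) hu1tb hu2ta hu2tb hu3ta hmx hxp1 hQanti hQmono
    hQsgn (hQzero m hu1tb.le (hz₀b m (hx₁a.trans_le hm1) hmx) hm3)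
    (hQzero xp (by linarith) (hg₁dd xp hxp1.le) hxp2) hu2tc hu3tb hchord
  have hgain : ∀ x, k / gb' g₁ g₂ bt u1t * gb g₁ g₂ bt x - k * x =
      k / gb' g₁ g₂ bt u1t * (gb g₁ g₂ bt x - gb' g₁ g₂ bt u1t * x) := fun x => by
    field_simp
  have hc : 0 < k / gb' g₁ g₂ bt u1t := div_pos hk hd
  have hgain1 : k / gb' g₁ g₂ bt u1t * (gb g₁ g₂ bt u1t - gb' g₁ g₂ bt u1t * u1t) = -K := by
    rw [← hgain]
    linarith [div_mul_eq_mul_div k (gb' g₁ g₂ bt u1t) (gb g₁ g₂ bt u1t),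
      mul_div_assoc k (gb g₁ g₂ bt u1t) (gb' g₁ g₂ bt u1t)]
  have hgain2 : k / gb' g₁ g₂ bt u1t * (gb g₁ g₂ bt u2t - gb' g₁ g₂ bt u1t * u2t) ≤ 0 := by
    have h : -Jfun k g₁ g₂ bt u1t u2t = k / gb' g₁ g₂ bt u1t *
        (gb g₁ g₂ bt u2t - gb' g₁ g₂ bt u1t * u2t) - k / gb' g₁ g₂ bt u1t *
        (gb g₁ g₂ bt u1t - gb' g₁ g₂ bt u1t * u1t) := by
      unfold Jfun
      rw [hu2tc]
      field_simp
      ring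
    rw [hgain1] at h
    linarith
  set V := Vfun k K (k / gb' g₁ g₂ 1 ubar) (k / gb' g₁ g₂ bt u1t) bt ubar u1t u3t g₁ g₂
    with hVdef
  have hVlow : ∀ x, x < ubar → V x = k / gb' g₁ g₂ 1 ubar * gb g₁ g₂ 1 x := fun x hx => by
    simp [hVdef, Vfun, hx]
  have hVmid : ∀ x, ubar ≤ x → x < u1t → V x = k * x - K := fun x h1 h2 => by
    simp [hVdef, Vfun, not_lt.2 h1, h2]
  have hVup : ∀ x, u1t ≤ x → x < u3t →
      V x = k / gb' g₁ g₂ bt u1t * gb g₁ g₂ bt x := fun x h1 h2 => by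
    simp [hVdef, Vfun, not_lt.2 (hu1ta.le.trans h1), not_lt.2 h1, h2]
  have hVhigh : ∀ x, u3t ≤ x → V x = k * x - K := fun x h => by
    simp [hVdef, Vfun, not_lt.2 (hu1ta.le.trans (hu13.le.trans h)), not_lt.2 (hu13.le.trans h),
      not_lt.2 h]
  have hVu1 : V u1t = k * u1t - K := by
    rw [hVup u1t le_rfl hu13]; linarith [hgain u1t]
  have hanti : StrictAntiOn (fun x => k / gb' g₁ g₂ 1 ubar * gb g₁ g₂ 1 x - k * x)
      (Icc 0 ubar) := by
    have hD : ∀ x, HasDerivAt (fun x => k / gb' g₁ g₂ 1 ubar * gb g₁ g₂ 1 x - k * x)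
        (k / gb' g₁ g₂ 1 ubar * gb' g₁ g₂ 1 x - k) x := fun x =>
      (((hgb 1 x).const_mul _).sub ((hasDerivAt_id x).const_mul k)).congr_deriv
        (by rw [mul_one])
    have hmon : StrictMonoOn (gb' g₁ g₂ 1) (Icc 0 ubar) := by
      refine strictMonoOn_of_deriv_pos (convex_Icc _ _)
        (fun x _ => (hgb' 1 x).continuousAt.continuousWithinAt) fun x hx => ?_
      rw [interior_Icc] at hx
      rw [(hgb' 1 x).deriv]
      exact hx₁c x hx.1.le (hx.2.trans hubar1)
    refine strictAntiOn_of_deriv_neg (convex_Icc _ _)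
      (fun x _ => (hD x).continuousAt.continuousWithinAt) fun x hx => ?_
    rw [interior_Icc] at hx
    have h := hmon ⟨hx.1.le, hx.2.le⟩ ⟨hubar0.le, le_rfl⟩ hx.2
    rw [(hD x).deriv, sub_neg, div_mul_eq_mul_div, div_lt_iff₀ hd0]
    exact mul_lt_mul_of_pos_left h hk
  have hV0 : V 0 = 0 := by rw [hVlow 0 hubar0, hg0, mul_zero]
  have hgainubar : k / gb' g₁ g₂ 1 ubar * gb g₁ g₂ 1 ubar - k * ubar = -K := by
    linarith [div_mul_eq_mul_div k (gb' g₁ g₂ 1 ubar) (gb g₁ g₂ 1 ubar),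
      mul_div_assoc k (gb g₁ g₂ 1 ubar) (gb' g₁ g₂ 1 ubar)]
  have hVle : ∀ y, 0 ≤ y → V y ≤ k * y := fun y hy => by
    rcases lt_or_ge y ubar with h | h
    · have := hanti.antitoneOn ⟨le_rfl, hubar0.le⟩ ⟨hy, h.le⟩ hy
      simp only [hg0, mul_zero, sub_zero] at this
      rw [hVlow y h]
      linarith
    rcases lt_or_ge y u1t with h1 | h1
    · rw [hVmid y h h1]; linarith
    rcases lt_or_ge y u3t with h2 | h2
    · rcases h1.eq_or_lt with rfl | h1
      · linarith
      have := mul_le_mul_of_nonneg_left (hbounds y ⟨h1, h2⟩).2 hc.le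
      rw [hVup y h1.le h2]
      linarith [hgain y]
    · rw [hVhigh y h2]; linarith
  have hM : ∀ x, 0 ≤ x → Mop k K V x = k * x - K := fun x hx =>
    Mop_eq_of_net_nonpos hV0 hVle hx
  constructor
  · rintro x (⟨h1, h2⟩ | h)
    · rw [hM x (hubar0.le.trans h1)]
      rcases h2.eq_or_lt with rfl | h2
      · exact hVu1.symm
      · exact (hVmid x h1 h2).symm
    · rw [hM x (hu1.le.trans (hu13.le.trans h)), hVhigh x h]
  · rintro x (⟨h1, h2⟩ | ⟨h1, h2⟩)
    · have := hanti ⟨h1.le, h2.le⟩ ⟨hubar0.le, le_rfl⟩ h2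
      simp only [hgainubar] at this
      rw [hM x h1.le, hVlow x h2]
      linarith
    · have := mul_lt_mul_of_pos_left (hbounds x ⟨h1, h2⟩).1 hc
      rw [hM x (hu1.trans h1).le, hVup x h1.le h2]
      linarith [hgain x]
end
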